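/- arXiv:1509.05752 — 3 statements merged into one kernel-verified Lean document; each statement's English description precedes it below -/
import Mathlib

section
/- Fix α, β ∈ (0, ∞). Let A_n^{(3)} be the number of boxes on the third main diagonal of a random α/β-staircase tableau of size n that contain α. Then A_n^{(3)} converges in distribution to a Poisson random variable with parameter 1/2: for every integer k ≥ 0, ℙ_{n,α,β}(A_n^{(3)} = k) → e^{−1/2} (1/2)^k / k! as n → ∞. -/
open scoped BigOperators

/-- A symbol in an α/β-staircase tableau: empty, α, or β. -/
inductive StairSymb : Type
  | empty : StairSymb
  | alpha : StairSymb
  | beta  : StairSymb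
  deriving DecidableEq

/-- `S` is an α/β-staircase tableau of size `n` (1-based indexing; boxes are the
pairs `(i,j)` with `1 ≤ i`, `1 ≤ j`, `i + j ≤ n + 1`; outside the boxes `S` is empty). -/
def IsStaircase (n : ℕ) (S : ℕ → ℕ → StairSymb) : Prop :=
  (∀ i j, ¬(1 ≤ i ∧ 1 ≤ j ∧ i + j ≤ n + 1) → S i j = StairSymb.empty) ∧
  (∀ i i' j, 1 ≤ i → i < i' → 1 ≤ j → i' + j ≤ n + 1 →
    S i' j = StairSymb.alpha → S i j = StairSymb.empty) ∧
  (∀ i j j', 1 ≤ i → 1 ≤ j → j < j' → i + j' ≤ n + 1 →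
    S i j' = StairSymb.beta → S i j = StairSymb.empty) ∧
  (∀ i j, 1 ≤ i → 1 ≤ j → i + j = n + 1 → S i j ≠ StairSymb.empty)

/-- The weight `wt(S) = α^{N_α(S)} β^{N_β(S)}` of a tableau. -/
noncomputable def stairWt (α β : ℝ) (S : ℕ → ℕ → StairSymb) : ℝ :=
  α ^ Set.ncard {p : ℕ × ℕ | S p.1 p.2 = StairSymb.alpha} *
  β ^ Set.ncard {p : ℕ × ℕ | S p.1 p.2 = StairSymb.beta}

/-- The partition function `Z_n(α,β)`, the total weight of all tableaux of size `n`. -/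
noncomputable def stairZ (n : ℕ) (α β : ℝ) : ℝ :=
  ∑ᶠ S ∈ {S : ℕ → ℕ → StairSymb | IsStaircase n S}, stairWt α β S

/-- The probability `ℙ_{n,α,β}(E)` of an event `E` (a set of tableaux of size `n`). -/
noncomputable def stairP (n : ℕ) (α β : ℝ) (E : (ℕ → ℕ → StairSymb) → Prop) : ℝ :=
  (∑ᶠ S ∈ {S : ℕ → ℕ → StairSymb | IsStaircase n S ∧ E S}, stairWt α β S) / stairZ n α β

/-- The expectation `E_{n,α,β}[f]` of a real function of the random tableau. -/
noncomputable def stairE (n : ℕ) (α β : ℝ) (f : (ℕ → ℕ → StairSymb) → ℝ) : ℝ :=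
  (∑ᶠ S ∈ {S : ℕ → ℕ → StairSymb | IsStaircase n S}, f S * stairWt α β S) / stairZ n α β


namespace StairSymb

/-- The weight of a single box. -/
def weight {R : Type*} [CommRing R] (α β : R) : StairSymb → R
  | empty => 1
  | alpha => α
  | beta => β

end StairSymb

namespace Staircase

open Finset StairSymb

/-- Prepend the column `c` to the array `S`. -/
def cons (c : ℕ → StairSymb) (S : ℕ → ℕ → StairSymb) : ℕ → ℕ → StairSymb
  | _, 0 => empty
  | i, 1 => c i
  | i, j + 2 => S i (j + 1)

/-- The column of length `n + 1` with `β`'s exactly at `B` and, unless `k = n + 1`, at the bottom,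
and with an `α` at `k` (no `α` at all if `k = 0`). -/
def col (n k : ℕ) (B : Finset ℕ) (i : ℕ) : StairSymb :=
  if i = 0 then empty else if i = k then alpha else if i ∈ B ∨ i = n + 1 then beta else empty

open Classical in
/-- The rows of `S` which contain no `β`. -/
noncomputable def free (n : ℕ) (S : ℕ → ℕ → StairSymb) : Finset ℕ :=
  {i ∈ Icc 1 n | ∀ j ∈ Icc 1 n, S i j ≠ beta}

/-- The pairs `(k, B)` for which `col n k B` may be put in front of a tableau of size `n` whose set
of `β`-free rows is `A`. -/
def codes (n : ℕ) (A : Finset ℕ) : Finset (Σ _ : ℕ, Finset ℕ) :=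
  (insert 0 (insert (n + 1) A)).sigma fun k => {i ∈ A | k < i}.powerset

open Classical in
/-- The finite set of staircase tableaux of size `n`, built column by column. -/
noncomputable def tableaux : ℕ → Finset (ℕ → ℕ → StairSymb)
  | 0 => {fun _ _ => empty}
  | n + 1 => ((tableaux n).sigma fun S => codes n (free n S)).image
      fun p => cons (col n p.2.1 p.2.2) p.1

theorem mem_free {n : ℕ} {S : ℕ → ℕ → StairSymb} {i : ℕ} :
    i ∈ free n S ↔ (1 ≤ i ∧ i ≤ n) ∧ ∀ j, 1 ≤ j → j ≤ n → S i j ≠ beta := by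
  simp [free]

theorem mem_codes {n : ℕ} {A : Finset ℕ} {p : Σ _ : ℕ, Finset ℕ} :
    p ∈ codes n A ↔
      (p.1 = 0 ∨ p.1 = n + 1 ∨ p.1 ∈ A) ∧ p.2 ⊆ A ∧ ∀ i ∈ p.2, p.1 < i := by
  obtain ⟨k, B⟩ := p
  simp only [codes, mem_sigma, mem_insert, mem_powerset, and_congr_right_iff]
  intro _
  constructor
  · intro h
    exact ⟨fun i hi => (mem_filter.1 (h hi)).1, fun i hi => (mem_filter.1 (h hi)).2⟩
  · rintro ⟨h1, h2⟩ i hi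
    exact mem_filter.2 ⟨h1 hi, h2 i hi⟩

theorem col_eq_alpha {n k i : ℕ} {B : Finset ℕ} :
    col n k B i = alpha ↔ i ≠ 0 ∧ i = k := by
  unfold col; split_ifs <;> simp_all

theorem col_eq_beta {n k i : ℕ} {B : Finset ℕ} :
    col n k B i = beta ↔ i ≠ 0 ∧ i ≠ k ∧ (i ∈ B ∨ i = n + 1) := by
  unfold col; split_ifs <;> simp_all

theorem col_eq_empty {n k i : ℕ} {B : Finset ℕ} :
    col n k B i = empty ↔ i = 0 ∨ (i ≠ k ∧ i ∉ B ∧ i ≠ n + 1) := by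
  unfold col; split_ifs <;> simp_all; tauto

theorem isStaircase_cons {n : ℕ} {S : ℕ → ℕ → StairSymb} (hS : IsStaircase n S)
    {p : Σ _ : ℕ, Finset ℕ} (hp : p ∈ codes n (free n S)) :
    IsStaircase (n + 1) (cons (col n p.1 p.2) S) := by
  obtain ⟨k, B⟩ := p
  obtain ⟨hk, hB, hkB⟩ := mem_codes.1 hp
  simp only at hk hB hkB
  obtain ⟨h1, h2, h3, h4⟩ := hS
  have hB' : ∀ i ∈ B, 1 ≤ i ∧ i ≤ n := fun i hi => (mem_free.1 (hB hi)).1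
  have hk' : k ≤ n + 1 := by
    rcases hk with h | h | h
    · omega
    · omega
    · have := (mem_free.1 h).1; omega
  refine ⟨?_, ?_, ?_, ?_⟩
  · intro i j hij
    match j with
    | 0 => rfl
    | 1 =>
      refine col_eq_empty.2 ?_
      by_cases hi : i = 0
      · exact Or.inl hi
      · refine Or.inr ⟨by change i ≠ k; omega, fun h => ?_, by omega⟩
        have := hB' i h; omega
    | j + 2 => exact h1 i (j + 1) (by omega)
  · intro i i' j hi hii hj hij ha
    match j with
    | 1 =>
      have hik : i' = k := (col_eq_alpha.1 ha).2
      refine col_eq_empty.2 (Or.inr ⟨?_, fun h => ?_, by omega⟩)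
      · change i ≠ k; omega
      · have := hkB i h; omega
    | j + 2 => exact h2 i i' (j + 1) hi hii (by omega) (by omega) ha
  · intro i j j' hi hj hjj hij hb
    match j, j' with
    | 1, j' + 2 =>
      change S i (j' + 1) = beta at hb
      have hiA : i ∉ free n S := fun h => (mem_free.1 h).2 (j' + 1) (by omega) (by omega) hb
      refine col_eq_empty.2 (Or.inr ⟨?_, fun h => hiA (hB h), by omega⟩)
      rintro rfl
      rcases hk with h | h | h
      · omega
      · omega
      · exact hiA h
    | j + 2, j' + 2 => exact h3 i (j + 1) (j' + 1) hi (by omega) (by omega) (by omega) hb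
  · intro i j hi hj hij
    match j with
    | 1 =>
      intro h
      rcases col_eq_empty.1 h with h | h
      · omega
      · exact h.2.2 (by omega)
    | j + 2 => exact h4 i (j + 1) hi (by omega) (by omega)

theorem exists_cons_eq {n : ℕ} {S : ℕ → ℕ → StairSymb} (hS : IsStaircase (n + 1) S) :
    ∃ T, IsStaircase n T ∧ ∃ p ∈ codes n (free n T), cons (col n p.1 p.2) T = S := by
  obtain ⟨h1, h2, h3, h4⟩ := hS
  obtain ⟨T, hT⟩ : ∃ T : ℕ → ℕ → StairSymb, T = fun i j => if j = 0 then empty else S i (j + 1) :=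
    ⟨_, rfl⟩
  have hTS : ∀ i j, 1 ≤ j → T i j = S i (j + 1) := by
    intro i j hj; rw [hT]; simp [show j ≠ 0 by omega]
  have hT0 : ∀ i, T i 0 = empty := by intro i; rw [hT]; simp
  have hfree : ∀ i, 1 ≤ i → i ≤ n → S i 1 ≠ empty → i ∈ free n T := by
    intro i hi hin hne
    refine mem_free.2 ⟨⟨hi, hin⟩, fun j hj hjn hb => hne ?_⟩
    rw [hTS i j hj] at hb
    by_cases hij : i + (j + 1) ≤ n + 1 + 1
    · exact h3 i 1 (j + 1) hi le_rfl (by omega) hij hb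
    · rw [h1 i (j + 1) (by omega)] at hb; cases hb
  obtain ⟨k, hk⟩ : ∃ k, (k = 0 ∧ ∀ i, S i 1 ≠ alpha) ∨ S k 1 = alpha := by
    by_cases h : ∃ i, S i 1 = alpha
    · obtain ⟨i, hi⟩ := h; exact ⟨i, Or.inr hi⟩
    · exact ⟨0, Or.inl ⟨rfl, fun i hi => h ⟨i, hi⟩⟩⟩
  have hbox : ∀ i, S i 1 ≠ empty → 1 ≤ i ∧ i ≤ n + 1 := by
    intro i hi
    by_contra h
    exact hi (h1 i 1 (by omega))
  refine ⟨T, ⟨?_, ?_, ?_, ?_⟩, ⟨k, {i ∈ Icc 1 n | S i 1 = beta}⟩, mem_codes.2 ⟨?_, ?_, ?_⟩, ?_⟩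
  · intro i j hij
    rcases Nat.eq_zero_or_pos j with rfl | hj
    · exact hT0 i
    · rw [hTS i j hj]; exact h1 i (j + 1) (by omega)
  · intro i i' j hi hii hj hij ha
    rw [hTS _ _ hj] at ha ⊢
    exact h2 i i' (j + 1) hi hii (by omega) (by omega) ha
  · intro i j j' hi hj hjj hij hb
    rw [hTS _ _ (by omega)] at hb ⊢
    exact h3 i (j + 1) (j' + 1) hi (by omega) (by omega) (by omega) hb
  · intro i j hi hj hij
    rw [hTS _ _ hj]
    exact h4 i (j + 1) hi (by omega) (by omega)
  · rcases hk with h | h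
    · exact Or.inl h.1
    · right
      have hne : S k 1 ≠ empty := by rw [h]; simp
      have := hbox k hne
      rcases Nat.lt_or_ge n k with h' | h'
      · left; change k = n + 1; omega
      · exact Or.inr (hfree k this.1 h' hne)
  · intro i hi
    simp only [mem_filter, mem_Icc] at hi
    exact hfree i hi.1.1 hi.1.2 (by rw [hi.2]; simp)
  · intro i hi
    simp only [mem_filter, mem_Icc] at hi
    rcases hk with h | h
    · simp only; omega
    · by_contra hlt
      simp only [not_lt] at hlt
      have hne : i ≠ k := by rintro rfl; rw [h] at hi; exact absurd hi.2 (by simp)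
      have hkb := hbox k (by rw [h]; simp)
      have := h2 i k 1 hi.1.1 (by omega) le_rfl (by omega) h
      rw [this] at hi
      exact absurd hi.2 (by simp)
  · funext i j
    match j with
    | 0 => exact (h1 i 0 (by omega)).symm
    | 1 =>
      change col n k _ i = S i 1
      rcases hS : S i 1 with _ | _ | _
      · refine col_eq_empty.2 ?_
        by_cases hi : i = 0
        · exact Or.inl hi
        · refine Or.inr ⟨?_, ?_, ?_⟩
          · rintro rfl
            rcases hk with h | h
            · exact hi h.1
            · rw [hS] at h; cases h
          · simp [hS]
          · rintro rfl
            exact h4 (n + 1) 1 (by omega) le_rfl rfl hS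
      · refine col_eq_alpha.2 ?_
        have hib := hbox i (by rw [hS]; simp)
        refine ⟨by omega, ?_⟩
        rcases hk with h | h
        · exact absurd hS (h.2 i)
        · have hkb := hbox k (by rw [h]; simp)
          rcases lt_trichotomy i k with hlt | heq | hlt
          · have := h2 i k 1 hib.1 hlt le_rfl (by omega) h
            rw [hS] at this; cases this
          · exact heq
          · have := h2 k i 1 hkb.1 hlt le_rfl (by omega) hS
            rw [h] at this; cases this
      · have hib := hbox i (by rw [hS]; simp)
        refine col_eq_beta.2 ⟨by omega, ?_, ?_⟩
        · rintro rfl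
          rcases hk with h | h
          · omega
          · rw [hS] at h; cases h
        · simp only [mem_filter, mem_Icc]
          by_cases h : i = n + 1
          · exact Or.inr h
          · exact Or.inl ⟨by omega, hS⟩
    | j + 2 => exact hTS i (j + 1) (by omega)

theorem mem_tableaux {n : ℕ} {S : ℕ → ℕ → StairSymb} :
    S ∈ tableaux n ↔ IsStaircase n S := by
  induction n generalizing S with
  | zero =>
    simp only [tableaux, mem_singleton]
    constructor
    · rintro rfl
      exact ⟨fun _ _ _ => rfl, fun _ _ _ _ _ _ _ _ => rfl, fun _ _ _ _ _ _ _ _ => rfl,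
        fun i j hi hj hij => by omega⟩
    · intro h
      funext i j
      exact h.1 i j (by omega)
  | succ n ih =>
    simp only [tableaux, mem_image, mem_sigma]
    constructor
    · rintro ⟨p, ⟨hS, hp⟩, rfl⟩
      exact isStaircase_cons (ih.1 hS) hp
    · intro h
      obtain ⟨T, hT, p, hp, rfl⟩ := exists_cons_eq h
      exact ⟨⟨T, p⟩, ⟨ih.2 hT, hp⟩, rfl⟩

theorem cons_injOn (n : ℕ) :
    Set.InjOn (fun p : Σ _ : ℕ → ℕ → StairSymb, Σ _ : ℕ, Finset ℕ => cons (col n p.2.1 p.2.2) p.1)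
      ((tableaux n).sigma fun S => codes n (free n S)) := by
  rintro ⟨S, k, B⟩ hp ⟨S', k', B'⟩ hp' heq
  simp only [coe_sigma, Set.mem_sigma_iff, mem_coe, mem_tableaux, mem_codes] at hp hp' heq
  obtain ⟨hS, hk, hB, hkB⟩ := hp
  obtain ⟨hS', hk', hB', hkB'⟩ := hp'
  have hSS : S = S' := by
    funext i j
    match j with
    | 0 => rw [hS.1 i 0 (by omega), hS'.1 i 0 (by omega)]
    | j + 1 => exact congrFun (congrFun heq i) (j + 2)
  have hc : ∀ i, col n k B i = col n k' B' i := fun i => congrFun (congrFun heq i) 1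
  have hkk : k = k' := by
    by_cases h0 : k = 0
    · by_contra hne
      have := (hc k').trans (col_eq_alpha.2 ⟨by omega, rfl⟩)
      exact hne (col_eq_alpha.1 this).2.symm
    · exact (col_eq_alpha.1 ((hc k).symm.trans (col_eq_alpha.2 ⟨h0, rfl⟩))).2
  have hsub : ∀ {B B' : Finset ℕ} {S}, B ⊆ free n S → (∀ i ∈ B, k < i) →
      (∀ i, col n k B i = col n k B' i) → B ⊆ B' := by
    intro B B' S hB hkB hc i hi
    have h1 := (mem_free.1 (hB hi)).1
    have h2 := hkB i hi
    have := (hc i).symm.trans (col_eq_beta.2 ⟨by omega, by omega, Or.inl hi⟩)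
    rcases (col_eq_beta.1 this).2.2 with h | h
    · exact h
    · omega
  subst hSS hkk
  have : B = B' := Subset.antisymm (hsub hB hkB hc) (hsub hB' hkB' fun i => (hc i).symm)
  subst this
  rfl

/-- The number of `α`'s on the third main diagonal. -/
def thirdCount (n : ℕ) (S : ℕ → ℕ → StairSymb) : ℕ :=
  #{j ∈ Icc 1 (n - 2) | S (n - j - 1) j = alpha}

theorem thirdCount_cons (n k : ℕ) (B : Finset ℕ) (S : ℕ → ℕ → StairSymb) :
    thirdCount (n + 1) (cons (col n k B) S) =
      thirdCount n S + if k ≠ 0 ∧ k + 1 = n then 1 else 0 := by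
  unfold thirdCount
  rw [card_filter, card_filter]
  rcases Nat.lt_or_ge n 2 with hn | hn
  · have h1 : Icc 1 (n + 1 - 2) = ∅ := Icc_eq_empty (by omega)
    have h2 : Icc 1 (n - 2) = ∅ := Icc_eq_empty (by omega)
    rw [h1, h2, if_neg (by omega)]
    rfl
  · obtain ⟨m, rfl⟩ := Nat.exists_eq_add_of_le hn
    have e1 : 2 + m + 1 - 2 = m + 1 := by omega
    have e2 : 2 + m - 2 = m := by omega
    rw [e1, e2, ← Ico_add_one_right_eq_Icc, ← Ico_add_one_right_eq_Icc, sum_Ico_eq_sum_range,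
      sum_Ico_eq_sum_range]
    simp only [Nat.add_sub_cancel]
    rw [sum_range_succ']
    congr 1
    · refine sum_congr rfl fun i _ => ?_
      have e3 : 2 + m + 1 - (1 + (i + 1)) - 1 = 2 + m - (1 + i) - 1 := by omega
      rw [e3, show 1 + (i + 1) = i + 2 by omega, show 1 + i = i + 1 by omega]
      rfl
    · have e3 : 2 + m + 1 - (1 + 0) - 1 = m + 1 := by omega
      rw [e3]
      change (if col (2 + m) k B (m + 1) = alpha then 1 else 0) = _
      simp only [col_eq_alpha]
      congr 1
      apply propext
      omega

theorem free_cons {n : ℕ} {S : ℕ → ℕ → StairSymb} {p : Σ _ : ℕ, Finset ℕ}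
    (hS : IsStaircase n S) (hp : p ∈ codes n (free n S)) :
    free (n + 1) (cons (col n p.1 p.2) S) =
      if p.1 = n + 1 then insert (n + 1) (free n S \ p.2) else free n S \ p.2 := by
  obtain ⟨k, B⟩ := p
  obtain ⟨hk, hB, hkB⟩ := mem_codes.1 hp
  simp only at hk hB hkB ⊢
  have key : ∀ i, i ∈ free (n + 1) (cons (col n k B) S) ↔
      (i = n + 1 ∧ k = n + 1) ∨ (i ∈ free n S ∧ i ∉ B) := by
    intro i
    rw [mem_free, mem_free]
    constructor
    · rintro ⟨⟨h1, h2⟩, h3⟩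
      have hc : ¬(i ≠ 0 ∧ i ≠ k ∧ (i ∈ B ∨ i = n + 1)) := fun h =>
        h3 1 le_rfl (by omega) (col_eq_beta.2 h)
      by_cases hi : i = n + 1
      · left
        refine ⟨hi, ?_⟩
        by_contra hk'
        exact hc ⟨by omega, by omega, Or.inr hi⟩
      · refine Or.inr ⟨⟨⟨h1, by omega⟩, fun j hj hjn => ?_⟩, fun hiB => ?_⟩
        · obtain ⟨j, rfl⟩ := Nat.exists_eq_add_of_le' hj
          exact h3 (j + 2) (by omega) (by omega)
        · have := hkB i hiB
          exact hc ⟨by omega, by omega, Or.inl hiB⟩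
    · rintro (⟨rfl, rfl⟩ | ⟨⟨⟨h1, h2⟩, h3⟩, h4⟩)
      · refine ⟨⟨by omega, le_rfl⟩, fun j hj hjn h => ?_⟩
        match j with
        | 1 => exact (col_eq_beta.1 h).2.1 rfl
        | j + 2 =>
          change S (n + 1) (j + 1) = beta at h
          rw [hS.1 _ _ (by omega)] at h
          cases h
      · refine ⟨⟨h1, by omega⟩, fun j hj hjn h => ?_⟩
        match j with
        | 1 =>
          rcases (col_eq_beta.1 h).2.2 with h | h
          · exact h4 h
          · omega
        | j + 2 => exact h3 (j + 1) (by omega) (by omega) h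
  ext i
  rw [key]
  split_ifs with h <;> simp [h]

section Weights

variable {R : Type*} [CommRing R]

/-- The weight of a tableau, with an additional factor `y` for each `α` on the third diagonal. -/
def markedWeight (α β y : R) (n : ℕ) (S : ℕ → ℕ → StairSymb) : R :=
  (∏ j ∈ range n, ∏ i ∈ range n, (S (i + 1) (j + 1)).weight α β) * y ^ thirdCount n S

/-- The factor in the weight of the column `col n k B` which does not depend on `B`. -/
def colFactor (α β y : R) (n k : ℕ) : R :=
  if k = 0 then β else if k = n + 1 then α else if k + 1 = n then α * β * y else α * β

theorem prod_weight_col (α β : R) {n k : ℕ} {B : Finset ℕ} (hk : k ≤ n + 1)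
    (hB : ∀ i ∈ B, 1 ≤ i ∧ i ≤ n) (hkB : ∀ i ∈ B, k < i) :
    ∏ i ∈ range (n + 1), (col n k B (i + 1)).weight α β =
      β ^ #B * if k = 0 then β else if k = n + 1 then α else α * β := by
  have h1 : ∀ i ∈ range (n + 1), (col n k B (i + 1)).weight α β =
      (if i + 1 ∈ B then β else 1) *
        ((if i + 1 = k then α else 1) * if i = n then if k = n + 1 then 1 else β else 1) := by
    intro i hi
    have hi := mem_range.1 hi
    by_cases hiB : i + 1 ∈ B
    · have h2 := hB _ hiB
      have h3 := hkB _ hiB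
      rw [col_eq_beta.2 ⟨by omega, by omega, Or.inl hiB⟩, if_pos hiB, if_neg (by omega),
        if_neg (by omega)]
      simp [StairSymb.weight]
    · by_cases hik : i + 1 = k
      · rw [col_eq_alpha.2 ⟨by omega, hik⟩, if_neg hiB, if_pos hik]
        by_cases hin : i = n
        · rw [if_pos hin, if_pos (by omega)]; simp [StairSymb.weight]
        · rw [if_neg hin]; simp [StairSymb.weight]
      · by_cases hin : i = n
        · rw [col_eq_beta.2 ⟨by omega, hik, Or.inr (by omega)⟩, if_neg hiB, if_neg hik, if_pos hin,
            if_neg (by omega)]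
          simp [StairSymb.weight]
        · rw [col_eq_empty.2 (Or.inr ⟨hik, hiB, by omega⟩), if_neg hiB, if_neg hik, if_neg hin]
          simp [StairSymb.weight]
  rw [prod_congr rfl h1, prod_mul_distrib, prod_mul_distrib]
  congr 1
  · rw [range_eq_Ico, prod_Ico_add' (fun i => if i ∈ B then β else 1), zero_add,
      Ico_add_one_right_eq_Icc, prod_ite_mem, inter_eq_right.2 fun i hi => mem_Icc.2 ⟨(hB i hi).1, (hB i hi).2.trans n.le_succ⟩,
      prod_const]
  · rw [prod_ite_eq', if_pos (self_mem_range_succ n)]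
    rcases Nat.eq_zero_or_pos k with rfl | hk0
    · simp
    · obtain ⟨l, rfl⟩ := Nat.exists_eq_add_of_le' hk0
      simp only [Nat.add_right_cancel_iff] at hk ⊢
      rw [prod_ite_eq', if_pos (mem_range.2 (by omega)), if_neg (Nat.succ_ne_zero l)]
      split_ifs <;> ring

theorem markedWeight_cons (α β y : R) {n : ℕ} {S : ℕ → ℕ → StairSymb} {p : Σ _ : ℕ, Finset ℕ}
    (hS : IsStaircase n S) (hp : p ∈ codes n (free n S)) :
    markedWeight α β y (n + 1) (cons (col n p.1 p.2) S) =
      markedWeight α β y n S * (β ^ #p.2 * colFactor α β y n p.1) := by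
  obtain ⟨k, B⟩ := p
  obtain ⟨hk, hB, hkB⟩ := mem_codes.1 hp
  simp only at hk hB hkB ⊢
  have hk' : k ≤ n + 1 := by
    rcases hk with h | h | h
    · omega
    · omega
    · have := (mem_free.1 h).1; omega
  unfold markedWeight
  rw [prod_range_succ', thirdCount_cons]
  have h1 : ∏ i ∈ range (n + 1), (cons (col n k B) S (i + 1) (0 + 1)).weight α β = _ :=
    prod_weight_col α β hk' (fun i hi => (mem_free.1 (hB hi)).1) hkB
  have h2 : ∀ j ∈ range n,
      ∏ i ∈ range (n + 1), (cons (col n k B) S (i + 1) (j + 1 + 1)).weight α β =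
        ∏ i ∈ range n, (S (i + 1) (j + 1)).weight α β := by
    intro j _
    rw [prod_range_succ]
    change _ * (S (n + 1) (j + 1)).weight α β = _
    rw [hS.1 _ _ (by omega)]
    simp [StairSymb.weight, cons]
  rw [h1, prod_congr rfl h2, pow_add]
  unfold colFactor
  by_cases h0 : k = 0
  · simp only [h0, if_true, ne_eq, not_true_eq_false, false_and, if_false, pow_zero]; ring
  · by_cases h3 : k = n + 1
    · rw [if_neg h0, if_pos h3, if_neg h0, if_pos h3, if_neg (by omega)]; ring
    · rw [if_neg h0, if_neg h3, if_neg h0, if_neg h3]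
      by_cases h4 : k + 1 = n
      · rw [if_pos ⟨h0, h4⟩, if_pos h4]; ring
      · rw [if_neg (fun h => h4 h.2), if_neg h4]; ring

/-- The generating function of tableaux of size `n`, where the `β`-free row `i` has weight `φ i`. -/
noncomputable def genFun (α β y : R) (n : ℕ) (φ : ℕ → R) : R :=
  ∑ S ∈ tableaux n, markedWeight α β y n S * ∏ i ∈ free n S, φ i

/-- Shift the weights of the rows below row `k` by `β`. -/
def shiftBelow (β : R) (φ : ℕ → R) (k i : ℕ) : R := if i ≤ k then φ i else φ i + β

theorem genFun_congr (α β y : R) {n : ℕ} {φ ψ : ℕ → R} (h : ∀ i, 1 ≤ i → i ≤ n → φ i = ψ i) :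
    genFun α β y n φ = genFun α β y n ψ := by
  unfold genFun
  refine sum_congr rfl fun S _ => ?_
  rw [prod_congr rfl fun i hi => h i (mem_free.1 hi).1.1 (mem_free.1 hi).1.2]

theorem sum_powerset_prod_sdiff (β : R) (φ : ℕ → R) (A : Finset ℕ) (k : ℕ) :
    ∑ B ∈ {i ∈ A | k < i}.powerset, β ^ #B * ∏ i ∈ A \ B, φ i =
      ∏ i ∈ A, shiftBelow β φ k i := by
  rw [← prod_filter_mul_prod_filter_not A (k < ·) (shiftBelow β φ k)]
  have h1 : ∏ i ∈ A with k < i, shiftBelow β φ k i = ∏ i ∈ A with k < i, (β + φ i) :=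
    prod_congr rfl fun i hi => by
      rw [shiftBelow, if_neg (not_le.2 (mem_filter.1 hi).2), add_comm]
  have h2 : ∏ i ∈ A with ¬k < i, shiftBelow β φ k i = ∏ i ∈ A with ¬k < i, φ i :=
    prod_congr rfl fun i hi => by
      rw [shiftBelow, if_pos (not_lt.1 (mem_filter.1 hi).2)]
  rw [h1, h2, prod_add, sum_mul]
  refine sum_congr rfl fun B hB => ?_
  rw [prod_const, mul_assoc]
  congr 1
  have hB := mem_powerset.1 hB
  rw [← prod_union]
  · refine prod_congr ?_ fun _ _ => rfl
    ext i
    have : i ∈ B → k < i := fun h => (mem_filter.1 (hB h)).2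
    simp only [mem_sdiff, mem_union, mem_filter]
    tauto
  · refine disjoint_left.2 fun i hi hi' => ?_
    exact (mem_filter.1 hi').2 (mem_filter.1 (mem_sdiff.1 hi).1).2

theorem prod_shiftBelow_sub (β : R) (φ : ℕ → R) (A : Finset ℕ) (k : ℕ) (hk : 1 ≤ k) :
    φ k * (∏ i ∈ A, shiftBelow β φ (k - 1) i - ∏ i ∈ A, shiftBelow β φ k i) =
      if k ∈ A then β * ∏ i ∈ A, shiftBelow β φ k i else 0 := by
  have hne : ∀ i, i ≠ k → shiftBelow β φ (k - 1) i = shiftBelow β φ k i := by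
    intro i hi
    unfold shiftBelow
    by_cases h : i ≤ k
    · rw [if_pos h, if_pos (by omega)]
    · rw [if_neg h, if_neg (by omega)]
  split_ifs with h
  · rw [← mul_prod_erase A _ h, ← mul_prod_erase A _ h,
      prod_congr rfl fun i hi => hne i (ne_of_mem_erase hi),
      show shiftBelow β φ k k = φ k from if_pos le_rfl,
      show shiftBelow β φ (k - 1) k = φ k + β from if_neg (by omega)]
    ring
  · rw [prod_congr rfl fun i hi => hne i (ne_of_mem_of_not_mem hi h), sub_self, mul_zero]

theorem genFun_succ (α β y : R) (n : ℕ) (φ : ℕ → R) :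
    genFun α β y (n + 1) φ =
      α * φ (n + 1) * genFun α β y n φ + β * genFun α β y n (fun i => φ i + β) +
        ∑ k ∈ Icc 1 n, α * (if k + 1 = n then y else 1) * φ k *
          (genFun α β y n (shiftBelow β φ (k - 1)) - genFun α β y n (shiftBelow β φ k)) := by
  classical
  have hstep : genFun α β y (n + 1) φ = ∑ S ∈ tableaux n, markedWeight α β y n S *
      ∑ k ∈ insert 0 (insert (n + 1) (free n S)), colFactor α β y n k *
        ((if k = n + 1 then φ (n + 1) else 1) * ∏ i ∈ free n S, shiftBelow β φ k i) := by
    unfold genFun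
    rw [tableaux, sum_image (cons_injOn n), sum_sigma]
    refine sum_congr rfl fun S hS => ?_
    have hS' := mem_tableaux.1 hS
    rw [mul_sum]
    have h1 : ∀ p ∈ codes n (free n S),
        markedWeight α β y (n + 1) (cons (col n p.1 p.2) S) *
          ∏ i ∈ free (n + 1) (cons (col n p.1 p.2) S), φ i =
        markedWeight α β y n S * (colFactor α β y n p.1 *
          ((if p.1 = n + 1 then φ (n + 1) else 1) * (β ^ #p.2 * ∏ i ∈ free n S \ p.2, φ i))) := by
      intro p hp
      rw [markedWeight_cons α β y hS' hp, free_cons hS' hp]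
      split_ifs with h
      · rw [prod_insert]
        · ring
        · intro h'
          have := (mem_free.1 (mem_sdiff.1 h').1).1
          omega
      · ring
    rw [sum_congr rfl h1, codes, sum_sigma]
    refine sum_congr rfl fun k _ => ?_
    rw [← sum_powerset_prod_sdiff, mul_sum, mul_sum, mul_sum]
  have h0 : ∀ S : ℕ → ℕ → StairSymb, 0 ∉ insert (n + 1) (free n S) := by
    intro S h
    rcases mem_insert.1 h with h | h
    · omega
    · have := (mem_free.1 h).1; omega
  have h1 : ∀ S : ℕ → ℕ → StairSymb, n + 1 ∉ free n S := by
    intro S h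
    have := (mem_free.1 h).1; omega
  have hle : ∀ S : ℕ → ℕ → StairSymb,
      ∏ i ∈ free n S, shiftBelow β φ (n + 1) i = ∏ i ∈ free n S, φ i := fun S =>
    prod_congr rfl fun i hi => if_pos (by have := (mem_free.1 hi).1; omega)
  have hge : ∀ S : ℕ → ℕ → StairSymb,
      ∏ i ∈ free n S, shiftBelow β φ 0 i = ∏ i ∈ free n S, (φ i + β) := fun S =>
    prod_congr rfl fun i hi => if_neg (by have := (mem_free.1 hi).1; omega)
  have hmid : ∀ S : ℕ → ℕ → StairSymb,
      ∑ k ∈ free n S, colFactor α β y n k *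
        ((if k = n + 1 then φ (n + 1) else 1) * ∏ i ∈ free n S, shiftBelow β φ k i) =
      ∑ k ∈ Icc 1 n, α * (if k + 1 = n then y else 1) * φ k *
        (∏ i ∈ free n S, shiftBelow β φ (k - 1) i - ∏ i ∈ free n S, shiftBelow β φ k i) := by
    intro S
    have hsub : free n S ⊆ Icc 1 n := fun i hi => mem_Icc.2 (mem_free.1 hi).1
    rw [← sum_subset hsub]
    · refine sum_congr rfl fun k hk => ?_
      have hk' := (mem_free.1 hk).1
      rw [mul_assoc _ (φ k), prod_shiftBelow_sub β φ _ k hk'.1, if_pos hk, colFactor,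
        if_neg (show ¬k = 0 by omega)]
      simp only [if_neg (show ¬k = n + 1 by omega)]
      split_ifs <;> ring
    · intro k hk hkS
      rw [mul_assoc _ (φ k), prod_shiftBelow_sub β φ _ k (mem_Icc.1 hk).1, if_neg hkS, mul_zero]
  rw [hstep]
  simp only [sum_insert (h0 _), sum_insert (h1 _), hmid, hle, hge]
  unfold genFun
  simp only [← sum_sub_distrib, mul_sum]
  rw [sum_comm, ← sum_add_distrib, ← sum_add_distrib]
  refine sum_congr rfl fun S _ => ?_
  simp only [colFactor, if_true, if_neg (Nat.succ_ne_zero n), if_neg (Nat.succ_ne_zero n).symm]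
  rw [mul_add, mul_add, mul_sum]
  have : ∀ a b c d e f : R, a = e → b = d → c = f → a + (b + c) = d + e + f := by
    intro a b c d e f h1 h2 h3; rw [h1, h2, h3]; ring
  refine this _ _ _ _ _ _ (by ring) (by ring) (sum_congr rfl fun k _ => by ring)

end Weights

section Recurrence

variable {R : Type*} [CommRing R]

/-- The generating function of tableaux of size `n`, where a `β`-free row has weight `v` if it is
the last row, `u` if it is the second to last row and `x` otherwise. -/
noncomputable def tailGenFun (α β y : R) (n : ℕ) (x u v : R) : R :=
  genFun α β y n fun i => if i = n then v else if i + 1 = n then u else x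

theorem tailGenFun_zero (α β y x u v : R) : tailGenFun α β y 0 x u v = 1 := by
  simp [tailGenFun, genFun, tableaux, markedWeight, thirdCount, free]

theorem tailGenFun_succ (α β y : R) (n : ℕ) (x v w : R) :
    tailGenFun α β y (n + 1) x v w =
      α * w * tailGenFun α β y n x x v +
        (β + α * x) * tailGenFun α β y n (x + β) (x + β) (v + β) -
        α * x * tailGenFun α β y n x x (v + β) +
        (y - 1) * α * x * (tailGenFun α β y n x (x + β) (v + β) - tailGenFun α β y n x x (v + β)) +
        α * v * (tailGenFun α β y n x x (v + β) - tailGenFun α β y n x x v) := by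
  rcases n with _ | m
  · rw [tailGenFun, genFun_succ]
    simp only [tailGenFun_zero]
    have h : ∀ φ : ℕ → R, genFun α β y 0 φ = 1 := fun φ =>
      (genFun_congr α β y fun i h1 h2 => by omega).trans (tailGenFun_zero α β y 0 0 0)
    simp only [h, Icc_eq_empty (show ¬1 ≤ 0 by omega), sum_empty, zero_add, if_true]
    ring
  · obtain ⟨φ, hφ⟩ : ∃ φ : ℕ → R,
        φ = fun i => if i = m + 1 + 1 then w else if i + 1 = m + 1 + 1 then v else x := ⟨_, rfl⟩
    have hw : φ (m + 1 + 1) = w := by simp [hφ]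
    have hv : φ (m + 1) = v := by simp [hφ]
    have hx : ∀ i, i ≤ m → φ i = x := by
      intro i hi
      rw [hφ]
      simp only [if_neg (show ¬i = m + 1 + 1 by omega), if_neg (show ¬i + 1 = m + 1 + 1 by omega)]
    have e1 : genFun α β y (m + 1) φ = tailGenFun α β y (m + 1) x x v :=
      genFun_congr α β y fun i h1 h2 => by
        by_cases h : i = m + 1
        · rw [h, hv, if_pos rfl]
        · rw [hx i (by omega), if_neg h, ite_self]
    have e2 : genFun α β y (m + 1) (fun i => φ i + β) =
        tailGenFun α β y (m + 1) (x + β) (x + β) (v + β) :=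
      genFun_congr α β y fun i h1 h2 => by
        by_cases h : i = m + 1
        · rw [h, hv, if_pos rfl]
        · rw [hx i (by omega), if_neg h, ite_self]
    have e3 : genFun α β y (m + 1) (shiftBelow β φ 0) =
        tailGenFun α β y (m + 1) (x + β) (x + β) (v + β) := by
      rw [← e2]
      exact genFun_congr α β y fun i h1 h2 => if_neg (by omega)
    have e4 : genFun α β y (m + 1) (shiftBelow β φ (m + 1)) =
        tailGenFun α β y (m + 1) x x v := by
      rw [← e1]
      exact genFun_congr α β y fun i h1 h2 => if_pos (by omega)
    have e5 : genFun α β y (m + 1) (shiftBelow β φ m) =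
        tailGenFun α β y (m + 1) x x (v + β) :=
      genFun_congr α β y fun i h1 h2 => by
        by_cases h : i = m + 1
        · rw [h, if_pos rfl, shiftBelow, if_neg (by omega), hv]
        · rw [if_neg h, ite_self, shiftBelow, if_pos (by omega), hx i (by omega)]
    have e6 : ∀ l, l + 1 = m → genFun α β y (m + 1) (shiftBelow β φ l) =
        tailGenFun α β y (m + 1) x (x + β) (v + β) := fun l hl =>
      genFun_congr α β y fun i h1 h2 => by
        by_cases h : i = m + 1
        · rw [h, if_pos rfl, shiftBelow, if_neg (by omega), hv]
        · rw [if_neg h]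
          by_cases h' : i + 1 = m + 1
          · rw [if_pos h', shiftBelow, if_neg (by omega), hx i (by omega)]
          · rw [if_neg h', shiftBelow, if_pos (by omega), hx i (by omega)]
    have e7 : m = 0 → tailGenFun α β y (m + 1) x (x + β) (v + β) =
        tailGenFun α β y (m + 1) x x (v + β) := fun hm =>
      genFun_congr α β y fun i h1 h2 => by
        have h : i = m + 1 := by omega
        rw [if_pos h, if_pos h]
    have hsplit : ∀ G : ℕ → R, ∑ k ∈ Icc 1 (m + 1),
        α * (if k + 1 = m + 1 then y else 1) * φ k * (G (k - 1) - G k) =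
        α * x * (G 0 - G m) + (if m = 0 then 0 else (y - 1) * α * x * (G (m - 1) - G m)) +
          α * v * (G m - G (m + 1)) := by
      intro G
      rw [← Ico_add_one_right_eq_Icc, sum_Ico_eq_sum_range, Nat.add_sub_cancel, sum_range_succ,
        show 1 + m = m + 1 by omega, hv, if_neg (by omega), mul_one, Nat.add_sub_cancel]
      congr 1
      have : ∀ k ∈ range m, α * (if 1 + k + 1 = m + 1 then y else 1) * φ (1 + k) *
          (G (1 + k - 1) - G (1 + k)) = α * x * (G k - G (k + 1)) +
            if k + 1 = m then (y - 1) * α * x * (G k - G (k + 1)) else 0 := by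
        intro k hk
        have hk := mem_range.1 hk
        rw [hx _ (by omega), show 1 + k - 1 = k by omega, show 1 + k = k + 1 by omega]
        by_cases h : k + 1 = m
        · rw [if_pos (by omega), if_pos h]; ring
        · rw [if_neg (by omega), if_neg h]; ring
      rw [sum_congr rfl this, sum_add_distrib, ← mul_sum, sum_range_sub']
      congr 1
      rcases m with _ | l
      · simp
      · simp
    rw [tailGenFun, ← hφ, genFun_succ, hw, e1, e2,
      hsplit fun k => genFun α β y (m + 1) (shiftBelow β φ k), e3, e4, e5]
    rcases m with _ | l
    · rw [if_pos rfl, e7 rfl]; ring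
    · rw [if_neg (by omega), e6 _ (by omega)]; ring

/-- The generating function where all `β`-free rows have weight `x`. -/
noncomputable def rowGenFun (α β y : R) (n : ℕ) (x : R) : R :=
  genFun α β y n fun _ => x

theorem tailGenFun_self (α β y : R) (n : ℕ) (x : R) :
    tailGenFun α β y n x x x = rowGenFun α β y n x := by
  simp [tailGenFun, rowGenFun]

theorem tailGenFun_sub (α β y : R) (n : ℕ) (x v w w' : R) :
    tailGenFun α β y (n + 1) x v w - tailGenFun α β y (n + 1) x v w' =
      α * (w - w') * tailGenFun α β y n x x v := by
  rw [tailGenFun_succ, tailGenFun_succ α β y n x v w']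
  ring

theorem rowGenFun_succ (α β y : R) (n : ℕ) (x : R) :
    rowGenFun α β y (n + 1) x = (α * x + β) * rowGenFun α β y n (x + β) +
      (y - 1) * α * x *
        (tailGenFun α β y n x (x + β) (x + β) - tailGenFun α β y n x x (x + β)) := by
  rw [← tailGenFun_self, tailGenFun_succ, tailGenFun_self, tailGenFun_self]
  ring

theorem tailGenFun_sub_left (α β y : R) (n : ℕ) (x : R) :
    tailGenFun α β y (n + 2) x (x + β) (x + β) - tailGenFun α β y (n + 2) x x (x + β) =
      2 * α ^ 2 * β ^ 2 * rowGenFun α β y n x +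
        α * β * (α * x + β) * rowGenFun α β y n (x + β) +
        (y - 1) * α ^ 2 * β * x *
          (tailGenFun α β y n x x (x + β) - rowGenFun α β y n x) := by
  have h1 := tailGenFun_sub α β y n x x (x + β) x
  have h2 := tailGenFun_sub α β y n (x + β) (x + β) (x + β + β) (x + β)
  have h3 := tailGenFun_sub α β y n x x (x + β + β) (x + β)
  have h4 := tailGenFun_sub α β y n x (x + β) (x + β + β) (x + β)
  rw [tailGenFun_succ α β y (n + 1) x (x + β), tailGenFun_succ α β y (n + 1) x x]
  simp only [tailGenFun_self] at *
  linear_combination (α * (x + β) - α * x) * h1 + (β + α * x) * h2 + (- α * x + α * (x + β)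
    - (y - 1) * α * x) * h3 + (y - 1) * α * x * h4

theorem rowGenFun_zero (α β y x : R) : rowGenFun α β y 0 x = 1 := by
  rw [← tailGenFun_self, tailGenFun_zero]

theorem rowGenFun_one (α β y x : R) : rowGenFun α β y 1 x = α * x + β := by
  simp [rowGenFun_succ, rowGenFun_zero, tailGenFun_zero]

theorem rowGenFun_two (α β y x : R) :
    rowGenFun α β y 2 x = (α * x + β) * (α * (x + β) + β) := by
  rw [rowGenFun_succ, rowGenFun_one, tailGenFun_succ, tailGenFun_succ α β y 0 x x]
  simp only [tailGenFun_zero]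
  ring

theorem rowGenFun_three (α β y x : R) :
    rowGenFun α β y 3 x = (α * x + β) * rowGenFun α β y 2 (x + β) +
      (y - 1) * α * x * (2 * α ^ 2 * β ^ 2 + α * β * (α * x + β)) := by
  rw [rowGenFun_succ, tailGenFun_sub_left]
  simp only [tailGenFun_zero, rowGenFun_zero]
  ring

theorem rowGenFun_add_four (α β y : R) (n : ℕ) (x : R) :
    rowGenFun α β y (n + 4) x = (α * x + β) * rowGenFun α β y (n + 3) (x + β) +
      (y - 1) * α * x * (2 * α ^ 2 * β ^ 2 * rowGenFun α β y (n + 1) x +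
        α * β * (α * x + β) * rowGenFun α β y (n + 1) (x + β) +
        (y - 1) * α ^ 3 * β ^ 2 * x * rowGenFun α β y n x) := by
  have h := tailGenFun_sub α β y n x x (x + β) x
  rw [tailGenFun_self, tailGenFun_self] at h
  rw [rowGenFun_succ, tailGenFun_sub_left]
  linear_combination (y - 1) * α * x * ((y - 1) * α ^ 2 * β * x) * h

end Recurrence

section Asymptotics

/-- The approximation `exp (z / 2 * (1 - t ^ 2 / s ^ 2))` to the normalized generating function of
size `s - t` at the row weight `β * t`. -/
noncomputable def approx (z : ℂ) (s t : ℝ) : ℂ := Complex.exp (z / 2 * ((1 - t ^ 2 / s ^ 2 : ℝ) : ℂ))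

theorem norm_half_mul_le {z : ℂ} (hz : ‖z‖ ≤ 2) (r : ℝ) : ‖z / 2 * (r : ℂ)‖ ≤ |r| := by
  rw [norm_mul, Complex.norm_real, Real.norm_eq_abs]
  refine mul_le_of_le_one_left (abs_nonneg r) ?_
  rw [norm_div, Complex.norm_ofNat]
  linarith

theorem norm_exp_le_three {w : ℂ} (hw : ‖w‖ ≤ 1) : ‖Complex.exp w‖ ≤ 3 :=
  (Complex.norm_exp_le_exp_norm w).trans <|
    (Real.exp_le_exp.2 hw).trans (Real.exp_one_lt_d9.le.trans (by norm_num))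

theorem norm_exp_sub_exp_le {u v : ℂ} (hv : ‖v‖ ≤ 1) (huv : ‖u - v‖ ≤ 1) :
    ‖Complex.exp u - Complex.exp v‖ ≤ 6 * ‖u - v‖ := by
  have h : Complex.exp u - Complex.exp v = Complex.exp v * (Complex.exp (u - v) - 1) := by
    rw [mul_sub, ← Complex.exp_add]; simp
  rw [h, norm_mul]
  calc _ ≤ 3 * (2 * ‖u - v‖) :=
        mul_le_mul (norm_exp_le_three hv) (Complex.norm_exp_sub_one_le huv) (norm_nonneg _)
          (by norm_num)
    _ = 6 * ‖u - v‖ := by ring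

theorem abs_one_sub_sq_div_le {s t : ℝ} (ht : 0 ≤ t) (hts : t ≤ s) : |1 - t ^ 2 / s ^ 2| ≤ 1 := by
  have h1 : t ^ 2 / s ^ 2 ≤ 1 := div_le_one_of_le₀ (pow_le_pow_left₀ ht hts 2) (sq_nonneg s)
  have h0 : 0 ≤ t ^ 2 / s ^ 2 := by positivity
  rw [abs_le]; constructor <;> linarith

theorem norm_exponent_le {z : ℂ} (hz : ‖z‖ ≤ 2) {s t : ℝ} (ht : 0 ≤ t) (hts : t ≤ s) :
    ‖z / 2 * ((1 - t ^ 2 / s ^ 2 : ℝ) : ℂ)‖ ≤ 1 :=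
  (norm_half_mul_le hz _).trans (abs_one_sub_sq_div_le ht hts)

theorem norm_approx_le {z : ℂ} (hz : ‖z‖ ≤ 2) {s t : ℝ} (ht : 0 ≤ t) (hts : t ≤ s) :
    ‖approx z s t‖ ≤ 3 :=
  norm_exp_le_three (norm_exponent_le hz ht hts)

theorem norm_approx_sub_approx_le {z : ℂ} (hz : ‖z‖ ≤ 2) {s s' t t' : ℝ} (ht : 0 ≤ t') (hts : t' ≤ s')
    (h : |t' ^ 2 / s' ^ 2 - t ^ 2 / s ^ 2| ≤ 1) :
    ‖approx z s t - approx z s' t'‖ ≤ 6 * |t' ^ 2 / s' ^ 2 - t ^ 2 / s ^ 2| := by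
  have e : z / 2 * ((1 - t ^ 2 / s ^ 2 : ℝ) : ℂ) - z / 2 * ((1 - t' ^ 2 / s' ^ 2 : ℝ) : ℂ) =
      z / 2 * ((t' ^ 2 / s' ^ 2 - t ^ 2 / s ^ 2 : ℝ) : ℂ) := by
    push_cast; ring
  have h1 := norm_half_mul_le hz (t' ^ 2 / s' ^ 2 - t ^ 2 / s ^ 2)
  rw [← e] at h1
  exact (norm_exp_sub_exp_le (norm_exponent_le hz ht hts) (h1.trans h)).trans (by linarith)

theorem norm_approx_sub_step_le {z : ℂ} (hz : ‖z‖ ≤ 2) {s t : ℝ} (ht : 0 ≤ t) (hts : t + 4 ≤ s) :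
    ‖approx z s t - approx z s (t + 1) * (1 + z * t / s ^ 2)‖ ≤ 15 / s ^ 2 := by
  have hs : 0 < s := by linarith
  have hsC : (s : ℂ) ≠ 0 := by exact_mod_cast hs.ne'
  set δ : ℂ := z / 2 * (((2 * t + 1) / s ^ 2 : ℝ) : ℂ) with hδ
  have e : approx z s t = approx z s (t + 1) * Complex.exp δ := by
    unfold approx
    rw [← Complex.exp_add]
    congr 1
    rw [hδ]; push_cast; field_simp; ring
  have hδ1 : ‖δ‖ ≤ 2 / s := by
    refine (norm_half_mul_le hz _).trans ?_
    rw [abs_of_nonneg (by positivity), div_le_div_iff₀ (by positivity) hs]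
    nlinarith
  have hδ2 : ‖δ‖ ≤ 1 := hδ1.trans (by rw [div_le_one hs]; linarith)
  have hδ3 : ‖δ - z * t / s ^ 2‖ ≤ 1 / s ^ 2 := by
    have : δ - z * t / s ^ 2 = z / 2 * ((1 / s ^ 2 : ℝ) : ℂ) := by
      rw [hδ]; push_cast; field_simp; ring
    rw [this]
    refine (norm_half_mul_le hz _).trans ?_
    rw [abs_of_nonneg (by positivity)]
  have e2 : approx z s t - approx z s (t + 1) * (1 + z * t / s ^ 2) =
      approx z s (t + 1) * ((Complex.exp δ - 1 - δ) + (δ - z * t / s ^ 2)) := by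
    rw [e]; ring
  rw [e2, norm_mul]
  have h1 : ‖(Complex.exp δ - 1 - δ) + (δ - z * t / s ^ 2)‖ ≤ 5 / s ^ 2 := by
    refine (norm_add_le _ _).trans ?_
    have h2 := Complex.norm_exp_sub_one_sub_id_le hδ2
    have h3 : ‖δ‖ ^ 2 ≤ (2 / s) ^ 2 := pow_le_pow_left₀ (norm_nonneg _) hδ1 2
    have h4 : (2 / s) ^ 2 + 1 / s ^ 2 = 5 / s ^ 2 := by field_simp; norm_num
    linarith
  calc _ ≤ 3 * (5 / s ^ 2) :=
        mul_le_mul (norm_approx_le hz (by linarith) (by linarith)) h1 (norm_nonneg _) (by norm_num)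
    _ = 15 / s ^ 2 := by ring

/-- The right-hand side of the recurrence for the normalized generating function, in terms of
`s = n + 4 + t`. -/
noncomputable def recStep (z : ℂ) (a s t : ℝ) (F₃ F₁ F₁' F₀ : ℂ) : ℂ :=
  F₃ + z * t / ((s - 1 + a) * (s - 2 + a)) * F₁ +
    2 * z * t / ((s - 1 + a) * (s - 2 + a) * (s - 3 + a)) * F₁' +
    z ^ 2 * t ^ 2 / ((s - 1 + a) * (s - 2 + a) * (s - 3 + a) * (s - 4 + a)) * F₀

theorem inv_le_of_le {b s r : ℝ} (hb : 0 < b) (hs : b + 4 ≤ s) (hr : s - 4 ≤ r) :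
    1 / r ≤ (1 + 4 / b) / s := by
  have hr0 : 0 < r := by linarith
  rw [div_le_div_iff₀ hr0 (by linarith)]
  have : 4 ≤ 4 / b * (s - 4) := by
    rw [div_mul_eq_mul_div, le_div_iff₀ hb]; linarith
  nlinarith [div_pos (show (0 : ℝ) < 4 by norm_num) hb]

section Coefficients

variable {z : ℂ} {a b s t : ℝ}

theorem norm_coeff_one_le (hz : ‖z‖ ≤ 2) (ha : 0 < a) (hb : 0 < b) (ht : b ≤ t)
    (hts : t + 4 ≤ s) :
    ‖z * t / ((s - 1 + a) * (s - 2 + a) : ℂ)‖ ≤ 2 * (1 + 4 / b) ^ 2 / s := by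
  have hs : 0 < s := by linarith
  have h1 := inv_le_of_le hb (show b + 4 ≤ s by linarith) (show s - 4 ≤ s - 1 + a by linarith)
  have h2 := inv_le_of_le hb (show b + 4 ≤ s by linarith) (show s - 4 ≤ s - 2 + a by linarith)
  have e : z * t / ((s - 1 + a) * (s - 2 + a) : ℂ) =
      z * ((t * (1 / (s - 1 + a)) * (1 / (s - 2 + a)) : ℝ) : ℂ) := by
    push_cast; simp only [div_eq_mul_inv, mul_inv, one_mul]; ring
  have p1 : 0 < s - 1 + a := by linarith
  have p2 : 0 < s - 2 + a := by linarith
  rw [e, norm_mul, Complex.norm_real, Real.norm_eq_abs,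
    abs_of_nonneg (by have := hb.trans_le ht; positivity)]
  calc _ ≤ 2 * (s * ((1 + 4 / b) / s) * ((1 + 4 / b) / s)) := by
        have := hb.trans_le ht
        gcongr
        linarith
    _ = _ := by field_simp

theorem norm_coeff_two_le (hz : ‖z‖ ≤ 2) (ha : 0 < a) (hb : 0 < b) (ht : b ≤ t)
    (hts : t + 4 ≤ s) :
    ‖2 * z * t / ((s - 1 + a) * (s - 2 + a) * (s - 3 + a) : ℂ)‖ ≤
      4 * (1 + 4 / b) ^ 3 / s ^ 2 := by
  have hs : 0 < s := by linarith
  have h1 := inv_le_of_le hb (show b + 4 ≤ s by linarith) (show s - 4 ≤ s - 1 + a by linarith)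
  have h2 := inv_le_of_le hb (show b + 4 ≤ s by linarith) (show s - 4 ≤ s - 2 + a by linarith)
  have h3 := inv_le_of_le hb (show b + 4 ≤ s by linarith) (show s - 4 ≤ s - 3 + a by linarith)
  have e : 2 * z * t / ((s - 1 + a) * (s - 2 + a) * (s - 3 + a) : ℂ) =
      z * ((2 * t * (1 / (s - 1 + a)) * (1 / (s - 2 + a)) * (1 / (s - 3 + a)) : ℝ) : ℂ) := by
    push_cast; simp only [div_eq_mul_inv, mul_inv, one_mul]; ring
  have p1 : 0 < s - 1 + a := by linarith
  have p2 : 0 < s - 2 + a := by linarith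
  have p3 : 0 < s - 3 + a := by linarith
  rw [e, norm_mul, Complex.norm_real, Real.norm_eq_abs,
    abs_of_nonneg (by have := hb.trans_le ht; positivity)]
  calc _ ≤ 2 * (2 * s * ((1 + 4 / b) / s) * ((1 + 4 / b) / s) * ((1 + 4 / b) / s)) := by
        have := hb.trans_le ht
        gcongr
        linarith
    _ = _ := by field_simp; norm_num

theorem norm_coeff_three_le (hz : ‖z‖ ≤ 2) (ha : 0 < a) (hb : 0 < b) (ht : b ≤ t)
    (hts : t + 4 ≤ s) :
    ‖z ^ 2 * t ^ 2 / ((s - 1 + a) * (s - 2 + a) * (s - 3 + a) * (s - 4 + a) : ℂ)‖ ≤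
      4 * (1 + 4 / b) ^ 4 / s ^ 2 := by
  have hs : 0 < s := by linarith
  have h1 := inv_le_of_le hb (show b + 4 ≤ s by linarith) (show s - 4 ≤ s - 1 + a by linarith)
  have h2 := inv_le_of_le hb (show b + 4 ≤ s by linarith) (show s - 4 ≤ s - 2 + a by linarith)
  have h3 := inv_le_of_le hb (show b + 4 ≤ s by linarith) (show s - 4 ≤ s - 3 + a by linarith)
  have h4 := inv_le_of_le hb (show b + 4 ≤ s by linarith) (show s - 4 ≤ s - 4 + a by linarith)
  have e : z ^ 2 * t ^ 2 / ((s - 1 + a) * (s - 2 + a) * (s - 3 + a) * (s - 4 + a) : ℂ) =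
      z ^ 2 * ((t ^ 2 * (1 / (s - 1 + a)) * (1 / (s - 2 + a)) * (1 / (s - 3 + a)) *
        (1 / (s - 4 + a)) : ℝ) : ℂ) := by
    push_cast; simp only [div_eq_mul_inv, mul_inv, one_mul]; ring
  have p1 : 0 < s - 1 + a := by linarith
  have p2 : 0 < s - 2 + a := by linarith
  have p3 : 0 < s - 3 + a := by linarith
  have p4 : 0 < s - 4 + a := by linarith
  rw [e, norm_mul, norm_pow, Complex.norm_real, Real.norm_eq_abs,
    abs_of_nonneg (by have := hb.trans_le ht; positivity)]
  calc _ ≤ 2 ^ 2 * (s ^ 2 * ((1 + 4 / b) / s) * ((1 + 4 / b) / s) * ((1 + 4 / b) / s) *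
        ((1 + 4 / b) / s)) := by
        have := hb.trans_le ht
        gcongr
        linarith
    _ = _ := by field_simp; norm_num

theorem abs_inv_sq_sub_le (ha : 0 < a) (hb : 0 < b) (hs : b + 4 ≤ s) :
    |1 / s ^ 2 - 1 / ((s - 1 + a) * (s - 2 + a))| ≤
      (2 * a + 3 + (a + 1) * (a + 2)) * (1 + 4 / b) ^ 2 / s ^ 3 := by
  have hs0 : 0 < s := by linarith
  have p1 : 0 < s - 1 + a := by linarith
  have p2 : 0 < s - 2 + a := by linarith
  have h1 := inv_le_of_le hb hs (show s - 4 ≤ s - 1 + a by linarith)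
  have h2 := inv_le_of_le hb hs (show s - 4 ≤ s - 2 + a by linarith)
  have e : 1 / s ^ 2 - 1 / ((s - 1 + a) * (s - 2 + a)) =
      ((2 * a - 3) * s + (a - 1) * (a - 2)) * (1 / s ^ 2) * (1 / (s - 1 + a)) *
        (1 / (s - 2 + a)) := by
    field_simp; ring
  have hn : |(2 * a - 3) * s + (a - 1) * (a - 2)| ≤ (2 * a + 3 + (a + 1) * (a + 2)) * s := by
    rw [abs_le]; constructor <;> nlinarith [mul_pos ha hs0, mul_pos ha ha]
  rw [e, abs_mul, abs_mul, abs_mul, abs_of_pos (one_div_pos.2 p1), abs_of_pos (one_div_pos.2 p2),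
    abs_of_pos (show 0 < 1 / s ^ 2 by positivity)]
  calc _ ≤ (2 * a + 3 + (a + 1) * (a + 2)) * s * (1 / s ^ 2) * ((1 + 4 / b) / s) *
        ((1 + 4 / b) / s) := by gcongr
    _ = _ := by field_simp

theorem norm_approx_sub_shift_le (hz : ‖z‖ ≤ 2) (ht : 0 ≤ t) (hts : t + 4 ≤ s) :
    ‖approx z s (t + 1) - approx z (s - 2) (t + 1)‖ ≤ 24 / s := by
  have hs : 0 < s := by linarith
  have hs2 : 0 < s - 2 := by linarith
  have e : (t + 1) ^ 2 / (s - 2) ^ 2 - (t + 1) ^ 2 / s ^ 2 =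
      (t + 1) ^ 2 / (s - 2) ^ 2 * ((4 * s - 4) / s ^ 2) := by
    field_simp; ring
  have h1 : (t + 1) ^ 2 / (s - 2) ^ 2 ≤ 1 :=
    div_le_one_of_le₀ (pow_le_pow_left₀ (by linarith) (by linarith) 2) (sq_nonneg _)
  have h2 : (4 * s - 4) / s ^ 2 ≤ 4 / s := by
    rw [div_le_div_iff₀ (by positivity) hs]; nlinarith
  have h3 : 0 ≤ (4 * s - 4) / s ^ 2 := div_nonneg (by linarith) (by positivity)
  have h4 : |(t + 1) ^ 2 / (s - 2) ^ 2 - (t + 1) ^ 2 / s ^ 2| ≤ 4 / s := by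
    rw [e, abs_of_nonneg (mul_nonneg (by positivity) h3)]
    exact (mul_le_of_le_one_left h3 h1).trans h2
  refine (norm_approx_sub_approx_le hz (by linarith) (by linarith)
    (h4.trans ((div_le_one hs).2 (by linarith)))).trans ?_
  calc _ ≤ 6 * (4 / s) := by gcongr
    _ = 24 / s := by ring

end Coefficients

theorem exists_norm_approx_sub_recStep_le {a b : ℝ} (ha : 0 < a) (hb : 0 < b) :
    ∃ C, 0 ≤ C ∧ ∀ z : ℂ, ‖z‖ ≤ 2 → ∀ s t : ℝ, b ≤ t → t + 4 ≤ s →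
      ‖approx z s t - recStep z a s t (approx z s (t + 1)) (approx z (s - 2) (t + 1))
        (approx z (s - 3) t) (approx z (s - 4) t)‖ ≤ C / s ^ 2 := by
  set L := 1 + 4 / b with hL
  set A := 2 * a + 3 + (a + 1) * (a + 2) with hA
  have hL0 : 0 < L := by positivity
  have hA0 : 0 < A := by positivity
  refine ⟨15 + 48 + 6 * (A * L ^ 2) + 12 * L ^ 3 + 12 * L ^ 4, by positivity, ?_⟩
  intro z hz s t ht hts
  have ht0 : 0 < t := hb.trans_le ht
  have hs : 0 < s := by linarith
  have e : approx z s t - recStep z a s t (approx z s (t + 1)) (approx z (s - 2) (t + 1))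
        (approx z (s - 3) t) (approx z (s - 4) t) =
      (approx z s t - approx z s (t + 1) * (1 + z * t / s ^ 2)) +
      z * ((t / s ^ 2 : ℝ) : ℂ) * (approx z s (t + 1) - approx z (s - 2) (t + 1)) +
      z * ((t * (1 / s ^ 2 - 1 / ((s - 1 + a) * (s - 2 + a))) : ℝ) : ℂ) *
        approx z (s - 2) (t + 1) -
      2 * z * t / ((s - 1 + a) * (s - 2 + a) * (s - 3 + a)) * approx z (s - 3) t -
      z ^ 2 * t ^ 2 / ((s - 1 + a) * (s - 2 + a) * (s - 3 + a) * (s - 4 + a)) *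
        approx z (s - 4) t := by
    unfold recStep; push_cast; ring
  have h1 := norm_approx_sub_step_le hz ht0.le hts
  have h2 : ‖z * ((t / s ^ 2 : ℝ) : ℂ) * (approx z s (t + 1) - approx z (s - 2) (t + 1))‖ ≤
      48 / s ^ 2 := by
    rw [norm_mul, norm_mul, Complex.norm_real, Real.norm_eq_abs, abs_of_pos (by positivity)]
    calc _ ≤ 2 * (s / s ^ 2) * (24 / s) := by
          have := norm_approx_sub_shift_le hz ht0.le hts
          gcongr
          linarith
      _ = _ := by field_simp; norm_num
  have h3 : ‖z * ((t * (1 / s ^ 2 - 1 / ((s - 1 + a) * (s - 2 + a))) : ℝ) : ℂ) *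
        approx z (s - 2) (t + 1)‖ ≤ 6 * (A * L ^ 2) / s ^ 2 := by
    rw [norm_mul, norm_mul, Complex.norm_real, Real.norm_eq_abs, abs_mul, abs_of_pos ht0]
    calc _ ≤ 2 * (s * (A * L ^ 2 / s ^ 3)) * 3 := by
          have := abs_inv_sq_sub_le ha hb (show b + 4 ≤ s by linarith)
          have := norm_approx_le hz (show 0 ≤ t + 1 by linarith) (show t + 1 ≤ s - 2 by linarith)
          gcongr
          linarith
      _ = _ := by field_simp; norm_num
  have h4 : ‖2 * z * t / ((s - 1 + a) * (s - 2 + a) * (s - 3 + a)) * approx z (s - 3) t‖ ≤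
      12 * L ^ 3 / s ^ 2 := by
    rw [norm_mul]
    calc _ ≤ 4 * L ^ 3 / s ^ 2 * 3 :=
          mul_le_mul (norm_coeff_two_le hz ha hb ht hts) (norm_approx_le hz ht0.le (by linarith))
            (norm_nonneg _) (by positivity)
      _ = _ := by ring
  have h5 : ‖z ^ 2 * t ^ 2 / ((s - 1 + a) * (s - 2 + a) * (s - 3 + a) * (s - 4 + a)) *
        approx z (s - 4) t‖ ≤ 12 * L ^ 4 / s ^ 2 := by
    rw [norm_mul]
    calc _ ≤ 4 * L ^ 4 / s ^ 2 * 3 :=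
          mul_le_mul (norm_coeff_three_le hz ha hb ht hts)
            (norm_approx_le hz ht0.le (by linarith)) (norm_nonneg _) (by positivity)
      _ = _ := by ring
  rw [e]
  calc _ ≤ 15 / s ^ 2 + 48 / s ^ 2 + 6 * (A * L ^ 2) / s ^ 2 + 12 * L ^ 3 / s ^ 2 +
        12 * L ^ 4 / s ^ 2 :=
        (norm_sub_le _ _).trans (add_le_add ((norm_sub_le _ _).trans (add_le_add
          ((norm_add_le _ _).trans (add_le_add ((norm_add_le _ _).trans
            (add_le_add h1 h2)) h3)) h4)) h5)
    _ = _ := by ring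

/-- The recurrence and the initial values of the normalized generating functions. -/
structure IsNormalizedSolution (z : ℂ) (a b : ℝ) (F : ℕ → ℝ → ℂ) : Prop where
  eq_one : ∀ n ≤ 2, ∀ t, b ≤ t → F n t = 1
  three : ∀ t, b ≤ t → F 3 t = 1 + z * t / ((t + a) * (t + a + 1))
  add_four : ∀ n t, b ≤ t → F (n + 4) t =
    recStep z a (n + 4 + t) t (F (n + 3) (t + 1)) (F (n + 1) (t + 1)) (F (n + 1) t) (F n t)

theorem norm_one_sub_approx_le {z : ℂ} (hz : ‖z‖ ≤ 2) {t : ℝ} (ht : 0 < t) (n : ℕ) (hn : n ≤ 3) :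
    ‖1 - approx z (n + t) t‖ ≤ 12 / (n + t) := by
  have hn' : (n : ℝ) ≤ 3 := by exact_mod_cast hn
  have hn0 : (0 : ℝ) ≤ n := n.cast_nonneg
  have h := norm_exponent_le hz ht.le (show t ≤ n + t by linarith)
  rw [norm_sub_rev]
  refine (Complex.norm_exp_sub_one_le h).trans ?_
  have h2 : |1 - t ^ 2 / (n + t) ^ 2| ≤ 6 / (n + t) := by
    have e : 1 - t ^ 2 / (n + t) ^ 2 = n * (n + 2 * t) / (n + t) ^ 2 := by
      field_simp; ring
    rw [e, abs_of_nonneg (by positivity), div_le_div_iff₀ (by positivity) (by positivity)]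
    have : (n : ℝ) * (n + 2 * t) ≤ 6 * (n + t) := by nlinarith
    nlinarith [mul_le_mul_of_nonneg_right this (show 0 ≤ n + t by linarith)]
  calc _ ≤ 2 * (6 / (n + t)) := by
        have := (norm_half_mul_le hz (1 - t ^ 2 / (n + t) ^ 2)).trans h2
        linarith
    _ = _ := by ring

theorem exists_norm_sub_approx_le {a b : ℝ} (ha : 0 < a) (hb : 0 < b) :
    ∃ C, ∀ z : ℂ, ‖z‖ ≤ 2 → ∀ F, IsNormalizedSolution z a b F → ∀ n : ℕ, ∀ t, b ≤ t →
      ‖F n t - approx z (n + t) t‖ ≤ C / (n + t) := by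
  obtain ⟨C₀, hC₀, hres⟩ := exists_norm_approx_sub_recStep_le ha hb
  set L := 1 + 4 / b with hL
  have hL1 : 1 ≤ L := by
    have : 0 < 4 / b := by positivity
    linarith
  have hL0 : 0 < L := by linarith
  set M := 4 * L ^ 4 with hM
  set K := 9 * M * L + 1 with hK
  have hM0 : 0 < M := by positivity
  have hK0 : 0 < K := by positivity
  set C := (C₀ + 18) * Real.exp (K * (K / b)) with hC
  have hC1 : 0 < C := by positivity
  have hlow : ∀ x s : ℝ, 0 ≤ x → b ≤ s → C₀ + 18 ≤ C * Real.exp (K * ((x - K) / s)) := by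
    intro x s hx hs
    have hs0 : 0 < s := hb.trans_le hs
    rw [hC, mul_assoc, ← Real.exp_add]
    refine le_mul_of_one_le_right (by positivity) (Real.one_le_exp ?_)
    have h1 : K / s ≤ K / b := by gcongr
    have h2 : 0 ≤ x / s := by positivity
    rw [← mul_add, sub_div]
    exact mul_nonneg hK0.le (by linarith)
  refine ⟨C * Real.exp K, fun z hz F hF => ?_⟩
  suffices H : ∀ n : ℕ, ∀ t, b ≤ t →
      ‖F n t - approx z (n + t) t‖ ≤ C / (n + t) * Real.exp (K * ((n - K) / (n + t))) by
    intro n t ht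
    have ht0 : 0 < t := hb.trans_le ht
    refine (H n t ht).trans ?_
    rw [mul_div_right_comm C]
    have h1 : (n - K) / (n + t) ≤ 1 := div_le_one_of_le₀ (by linarith) (by positivity)
    gcongr
    nlinarith
  have hbase : ∀ n : ℕ, n ≤ 3 → ∀ t, b ≤ t → ‖F n t - 1‖ ≤ 6 / (n + t) →
      ‖F n t - approx z (n + t) t‖ ≤ C / (n + t) * Real.exp (K * ((n - K) / (n + t))) := by
    intro n hn t ht hFn
    have ht0 : 0 < t := hb.trans_le ht
    have h1 := norm_one_sub_approx_le hz ht0 n hn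
    have hn0 : (0 : ℝ) ≤ n := n.cast_nonneg
    have h2 := hlow n (n + t) hn0 (by linarith)
    calc _ = ‖(F n t - 1) + (1 - approx z (n + t) t)‖ := by congr 1; ring
      _ ≤ 6 / (n + t) + 12 / (n + t) := (norm_add_le _ _).trans (add_le_add hFn h1)
      _ = 18 / (n + t) := by ring
      _ ≤ C * Real.exp (K * ((n - K) / (n + t))) / (n + t) := by
        gcongr
        linarith
      _ = _ := by ring
  intro n
  induction n using Nat.strong_induction_on with
  | _ n ih =>
  intro t ht
  have ht0 : 0 < t := hb.trans_le ht
  have hsmall : n ≤ 2 ∨ n = 3 ∨ ∃ m, n = m + 4 := by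
    rcases Nat.lt_or_ge n 4 with h | h
    · omega
    · exact Or.inr (Or.inr ⟨n - 4, by omega⟩)
  rcases hsmall with h | rfl | ⟨m, rfl⟩
  · refine hbase n (by omega) t ht ?_
    rw [hF.eq_one n h t ht, sub_self, norm_zero]
    positivity
  · refine hbase 3 le_rfl t ht ?_
    have e : F 3 t - 1 = z * ((t / ((t + a) * (t + a + 1)) : ℝ) : ℂ) := by
      rw [hF.three t ht]; push_cast; ring
    rw [e, norm_mul, Complex.norm_real, Real.norm_eq_abs, abs_of_pos (by positivity)]
    have h1 : t / ((t + a) * (t + a + 1)) ≤ 3 / (3 + t) := by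
      rw [div_le_div_iff₀ (by positivity) (by positivity)]
      nlinarith [mul_pos ht0 ha, mul_pos ha ha, mul_pos ht0 ht0]
    calc _ ≤ 2 * (3 / (3 + t)) := by gcongr
      _ = _ := by push_cast; ring
  · obtain ⟨s, hs⟩ : ∃ s : ℝ, s = m + 4 + t := ⟨_, rfl⟩
    have hm0 : (0 : ℝ) ≤ m := m.cast_nonneg
    have hts : t + 4 ≤ s := by linarith
    have hs0 : 0 < s := by linarith
    have hs1 : 1 ≤ s := by linarith
    have i3 := ih (m + 3) (by omega) (t + 1) (by linarith)
    have i1 := ih (m + 1) (by omega) (t + 1) (by linarith)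
    have i1' := ih (m + 1) (by omega) t ht
    have i0 := ih m (by omega) t ht
    rw [show ((m + 3 : ℕ) : ℝ) + (t + 1) = s by rw [hs]; push_cast; ring] at i3
    rw [show ((m + 1 : ℕ) : ℝ) + (t + 1) = s - 2 by rw [hs]; push_cast; ring] at i1
    rw [show ((m + 1 : ℕ) : ℝ) + t = s - 3 by rw [hs]; push_cast; ring] at i1'
    rw [show (m : ℝ) + t = s - 4 by rw [hs]; ring] at i0
    rw [show ((m + 4 : ℕ) : ℝ) + t = s by rw [hs]; push_cast; ring]
    set X := Real.exp (K * (((m + 3 : ℕ) - K) / s)) with hX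
    have hX0 : 0 < X := Real.exp_pos _
    have hX1 : C₀ + 18 ≤ C * X := hlow _ s (Nat.cast_nonneg _) (by linarith)
    have hbound : ∀ (j : ℕ) (r : ℝ), s - 4 ≤ r →
        (j - K) * (s * K) ≤ ((m + 3 - K) * K + s) * r →
        C / r * Real.exp (K * ((j - K) / r)) ≤ 3 * C * L / s * X := by
      intro j r hr hjr
      have hr0 : 0 < r := by linarith
      have h1 := inv_le_of_le hb (show b + 4 ≤ s by linarith) hr
      have h2 : (j - K) / r ≤ ((m + 3 : ℕ) - K) / s + 1 / K := by
        rw [div_add_div _ _ hs0.ne' hK0.ne', div_le_div_iff₀ hr0 (by positivity)]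
        push_cast; linarith
      have h3 : Real.exp (K * ((j - K) / r)) ≤ X * 3 :=
        calc _ ≤ Real.exp (K * (((m + 3 : ℕ) - K) / s) + 1) := by
              refine Real.exp_le_exp.2 ((mul_le_mul_of_nonneg_left h2 hK0.le).trans_eq ?_)
              rw [mul_add, mul_one_div_cancel hK0.ne']
          _ ≤ X * 3 := by
              rw [Real.exp_add]
              exact mul_le_mul_of_nonneg_left (Real.exp_one_lt_d9.le.trans (by norm_num)) hX0.le
      calc _ = C * (1 / r) * Real.exp (K * ((j - K) / r)) := by ring
        _ ≤ C * (L / s) * (X * 3) := by gcongr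
        _ = _ := by ring
    have j1 := i1.trans (hbound (m + 1) (s - 2) (by linarith)
      (by push_cast; rw [hs]; linarith [mul_pos hK0 hK0, mul_pos hK0 ht0, mul_nonneg hm0 hm0,
        mul_nonneg hm0 ht0.le, mul_pos ht0 ht0]))
    have j1' := i1'.trans (hbound (m + 1) (s - 3) (by linarith)
      (by push_cast; rw [hs]; linarith [sq_nonneg (m + 1 - K), mul_pos hK0 hK0, mul_pos hK0 ht0,
        mul_nonneg hm0 hm0, mul_nonneg hm0 ht0.le, mul_pos ht0 ht0, mul_nonneg hm0 hK0.le]))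
    have j0 := i0.trans (hbound m (s - 4) (by linarith)
      (by rw [hs]; linarith [sq_nonneg (m - K), mul_pos hK0 hK0, mul_pos hK0 ht0, mul_nonneg hm0 hm0,
        mul_nonneg hm0 ht0.le, mul_pos ht0 ht0, mul_nonneg hm0 hK0.le]))
    have hr := hres z hz s t ht hts
    have k1 : ‖z * t / ((s - 1 + a) * (s - 2 + a) : ℂ)‖ ≤ M / s := by
      refine (norm_coeff_one_le hz ha hb ht hts).trans ?_
      rw [← hL]
      have : L ^ 2 ≤ L ^ 4 := pow_le_pow_right₀ hL1 (by norm_num)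
      have : 0 ≤ L ^ 4 := by positivity
      gcongr
      rw [hM]; linarith
    have hss : s ≤ s ^ 2 := by nlinarith
    have k2 : ‖2 * z * t / ((s - 1 + a) * (s - 2 + a) * (s - 3 + a) : ℂ)‖ ≤ M / s := by
      refine (norm_coeff_two_le hz ha hb ht hts).trans ?_
      rw [← hL]
      have : L ^ 3 ≤ L ^ 4 := pow_le_pow_right₀ hL1 (by norm_num)
      exact div_le_div₀ (by positivity) (by rw [hM]; linarith) hs0 hss
    have k3 : ‖z ^ 2 * t ^ 2 / ((s - 1 + a) * (s - 2 + a) * (s - 3 + a) * (s - 4 + a) : ℂ)‖ ≤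
        M / s := by
      refine (norm_coeff_three_le hz ha hb ht hts).trans ?_
      rw [← hL]
      exact div_le_div₀ (by positivity) le_rfl hs0 hss
    have e : F (m + 4) t - approx z s t =
        (F (m + 3) (t + 1) - approx z s (t + 1)) +
        z * t / ((s - 1 + a) * (s - 2 + a)) * (F (m + 1) (t + 1) - approx z (s - 2) (t + 1)) +
        2 * z * t / ((s - 1 + a) * (s - 2 + a) * (s - 3 + a)) *
          (F (m + 1) t - approx z (s - 3) t) +
        z ^ 2 * t ^ 2 / ((s - 1 + a) * (s - 2 + a) * (s - 3 + a) * (s - 4 + a)) *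
          (F m t - approx z (s - 4) t) -
        (approx z s t - recStep z a s t (approx z s (t + 1)) (approx z (s - 2) (t + 1))
          (approx z (s - 3) t) (approx z (s - 4) t)) := by
      rw [hF.add_four m t ht, ← hs]
      unfold recStep
      ring
    have hM' : 0 ≤ M / s := by positivity
    have hexp : X * (1 + K / s) ≤ Real.exp (K * (((m + 4 : ℕ) - K) / s)) := by
      have : K * (((m + 4 : ℕ) - K) / s) = K * (((m + 3 : ℕ) - K) / s) + K / s := by
        push_cast; ring
      rw [this, Real.exp_add, ← hX]
      have := Real.add_one_le_exp (K / s)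
      gcongr
      linarith
    rw [e]
    calc _ ≤ C / s * X + M / s * (3 * C * L / s * X) + M / s * (3 * C * L / s * X) +
          M / s * (3 * C * L / s * X) + C₀ / s ^ 2 := by
          refine (norm_sub_le _ _).trans (add_le_add ((norm_add_le _ _).trans (add_le_add
            ((norm_add_le _ _).trans (add_le_add ((norm_add_le _ _).trans
            (add_le_add i3 ?_)) ?_)) ?_)) hr)
          · rw [norm_mul]; exact mul_le_mul k1 j1 (norm_nonneg _) hM'
          · rw [norm_mul]; exact mul_le_mul k2 j1' (norm_nonneg _) hM'
          · rw [norm_mul]; exact mul_le_mul k3 j0 (norm_nonneg _) hM'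
      _ ≤ C / s * X + M / s * (3 * C * L / s * X) + M / s * (3 * C * L / s * X) +
          M / s * (3 * C * L / s * X) + C * X / s ^ 2 := by
          gcongr
          linarith
      _ = C / s * (X * (1 + K / s)) := by rw [hK]; field_simp; ring
      _ ≤ _ := by gcongr

end Asymptotics

section Normalization

/-- The generating function of tableaux of size `n` with all row weights equal to `β * t` and
`y = 1`, see `rowGenFun_at_one`. -/
noncomputable def normFactor (α β : ℝ) (n : ℕ) (t : ℝ) : ℂ :=
  ∏ i ∈ range n, (α * β * (t + (α⁻¹ : ℝ) + i) : ℂ)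

theorem normFactor_succ (α β : ℝ) (n : ℕ) (t : ℝ) :
    normFactor α β (n + 1) t = α * β * (t + (α⁻¹ : ℝ) + n) * normFactor α β n t := by
  rw [normFactor, prod_range_succ, mul_comm, normFactor]

theorem normFactor_succ' (α β : ℝ) (n : ℕ) (t : ℝ) :
    normFactor α β (n + 1) t = α * β * (t + (α⁻¹ : ℝ)) * normFactor α β n (t + 1) := by
  rw [normFactor, prod_range_succ', mul_comm, normFactor]
  congr 1
  · push_cast; ring
  · exact prod_congr rfl fun i _ => by push_cast; ring

variable {α β : ℝ}

theorem add_inv_add_ne_zero (hα : 0 < α) {t : ℝ} (ht : 0 < t) (n : ℕ) :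
    (t + (α⁻¹ : ℝ) + n : ℂ) ≠ 0 := by
  have : 0 < t + α⁻¹ + n := by positivity
  exact_mod_cast this.ne'

theorem normFactor_ne_zero (hα : 0 < α) (hβ : 0 < β) {t : ℝ} (ht : 0 < t) (n : ℕ) :
    normFactor α β n t ≠ 0 := by
  refine prod_ne_zero_iff.2 fun i _ => mul_ne_zero (mul_ne_zero ?_ ?_) (add_inv_add_ne_zero hα ht i)
  · exact_mod_cast hα.ne'
  · exact_mod_cast hβ.ne'

theorem mul_mul_add_eq (hα : 0 < α) (t : ℝ) :
    (α * (β * t) + β : ℂ) = α * β * (t + (α⁻¹ : ℝ)) := by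
  have : (α : ℂ) ≠ 0 := by exact_mod_cast hα.ne'
  push_cast
  field_simp

theorem mul_add_eq (β t : ℝ) : (β * t + β : ℂ) = β * ((t + 1 : ℝ) : ℂ) := by
  push_cast; ring

theorem rowGenFun_at_one (hα : 0 < α) (n : ℕ) (t : ℝ) :
    rowGenFun (α : ℂ) β 1 n (β * t) = normFactor α β n t := by
  induction n generalizing t with
  | zero => simp [rowGenFun_zero, normFactor]
  | succ n ih =>
    rw [rowGenFun_succ, mul_add_eq, ih, normFactor_succ', mul_mul_add_eq hα]
    ring

theorem isNormalizedSolution_rowGenFun (hα : 0 < α) (hβ : 0 < β) (y : ℂ) {b : ℝ} (hb : 0 < b) :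
    IsNormalizedSolution (y - 1) α⁻¹ b
      fun n t => rowGenFun (α : ℂ) β y n (β * t) / normFactor α β n t := by
  have hα' : (α : ℂ) ≠ 0 := by exact_mod_cast hα.ne'
  have hβ' : (β : ℂ) ≠ 0 := by exact_mod_cast hβ.ne'
  have htwo : ∀ t : ℝ, rowGenFun (α : ℂ) β y 2 (β * t) = normFactor α β 2 t := by
    intro t
    rw [rowGenFun_two, mul_add_eq, mul_mul_add_eq hα, mul_mul_add_eq hα, normFactor_succ',
      normFactor_succ']
    simp [normFactor]
  refine ⟨fun n hn t ht => ?_, fun t ht => ?_, fun n t ht => ?_⟩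
  · rw [div_eq_one_iff_eq (normFactor_ne_zero hα hβ (hb.trans_le ht) n)]
    interval_cases n
    · simp [rowGenFun_zero, normFactor]
    · rw [rowGenFun_one, mul_mul_add_eq hα]
      simp [normFactor]
    · exact htwo t
  · have ht0 := hb.trans_le ht
    have h0 := add_inv_add_ne_zero hα ht0 0
    have h1 := add_inv_add_ne_zero hα ht0 1
    have h2 := add_inv_add_ne_zero hα ht0 2
    have e : normFactor α β 3 t = α * β * (t + (α⁻¹ : ℝ)) * normFactor α β 2 (t + 1) :=
      normFactor_succ' α β 2 t
    have e' : normFactor α β 3 t = (α * β) ^ 3 *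
        ((t + (α⁻¹ : ℝ) + (0 : ℕ)) * (t + (α⁻¹ : ℝ) + (1 : ℕ)) * (t + (α⁻¹ : ℝ) + (2 : ℕ))) := by
      simp only [normFactor, prod_range_succ, prod_range_zero]
      ring
    rw [rowGenFun_three, mul_add_eq, htwo, mul_mul_add_eq hα, ← e, add_div,
      div_self (normFactor_ne_zero hα hβ ht0 3), e']
    simp only [Nat.cast_zero, Nat.cast_one, Nat.cast_ofNat, add_zero] at h0 h1 h2 ⊢
    generalize ((α⁻¹ : ℝ) : ℂ) = a at h0 h1 h2 ⊢
    congr 1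
    field_simp
    ring
  · have ht0 := hb.trans_le ht
    have h0 := add_inv_add_ne_zero hα ht0 n
    have h1 := add_inv_add_ne_zero hα ht0 (n + 1)
    have h2 := add_inv_add_ne_zero hα ht0 (n + 2)
    have h3 := add_inv_add_ne_zero hα ht0 (n + 3)
    have q := normFactor_ne_zero hα hβ ht0 n
    have e1 := normFactor_succ α β n t
    have e2 := normFactor_succ α β (n + 1) t
    have e3 := normFactor_succ α β (n + 2) t
    have e4 := normFactor_succ α β (n + 3) t
    have e2' := normFactor_succ' α β (n + 1) t
    have e4' := normFactor_succ' α β (n + 3) t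
    have r1 : (((n + 4 + t : ℝ) : ℂ) - 1 + (α⁻¹ : ℝ)) = t + (α⁻¹ : ℝ) + (n + 3 : ℕ) := by
      push_cast; ring
    have r2 : (((n + 4 + t : ℝ) : ℂ) - 2 + (α⁻¹ : ℝ)) = t + (α⁻¹ : ℝ) + (n + 2 : ℕ) := by
      push_cast; ring
    have r3 : (((n + 4 + t : ℝ) : ℂ) - 3 + (α⁻¹ : ℝ)) = t + (α⁻¹ : ℝ) + (n + 1 : ℕ) := by
      push_cast; ring
    have r4 : (((n + 4 + t : ℝ) : ℂ) - 4 + (α⁻¹ : ℝ)) = t + (α⁻¹ : ℝ) + (n : ℕ) := by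
      push_cast; ring
    unfold recStep
    rw [r1, r2, r3, r4, rowGenFun_add_four, mul_add_eq, mul_mul_add_eq hα]
    rw [e3, e2, e1] at e4
    rw [e1] at e2
    rw [e4] at e4'
    rw [e2] at e2'
    have hp := add_inv_add_ne_zero hα ht0 0
    rw [Nat.cast_zero, add_zero] at hp
    have d3 : normFactor α β (n + 3) (t + 1) = (α * β) ^ 3 * (t + (α⁻¹ : ℝ) + (n + 3 : ℕ)) *
        (t + (α⁻¹ : ℝ) + (n + 2 : ℕ)) * (t + (α⁻¹ : ℝ) + (n + 1 : ℕ)) * (t + (α⁻¹ : ℝ) + (n : ℕ)) *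
        normFactor α β n t / (t + (α⁻¹ : ℝ)) := by
      rw [eq_div_iff hp]
      refine mul_left_cancel₀ (mul_ne_zero hα' hβ') ?_
      linear_combination -e4'
    have d1 : normFactor α β (n + 1) (t + 1) = α * β * (t + (α⁻¹ : ℝ) + (n + 1 : ℕ)) *
        (t + (α⁻¹ : ℝ) + (n : ℕ)) * normFactor α β n t / (t + (α⁻¹ : ℝ)) := by
      rw [eq_div_iff hp]
      refine mul_left_cancel₀ (mul_ne_zero hα' hβ') ?_
      linear_combination -e2'
    rw [e4, d3, d1, e1]
    generalize (t + (α⁻¹ : ℝ) + (n + 3 : ℕ) : ℂ) = p3 at h3 ⊢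
    generalize (t + (α⁻¹ : ℝ) + (n + 2 : ℕ) : ℂ) = p2 at h2 ⊢
    generalize (t + (α⁻¹ : ℝ) + (n + 1 : ℕ) : ℂ) = p1 at h1 ⊢
    generalize (t + (α⁻¹ : ℝ) + (n : ℕ) : ℂ) = p0 at h0 ⊢
    generalize (t + (α⁻¹ : ℝ) : ℂ) = p at hp ⊢
    field_simp
    ring

end Normalization

/-- The probability generating function of the third diagonal converges to `exp ((y - 1) / 2)`
uniformly on the closed unit disc. -/
theorem exists_norm_rowGenFun_sub_exp_le {α β : ℝ} (hα : 0 < α) (hβ : 0 < β) :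
    ∃ C, ∀ y : ℂ, ‖y‖ ≤ 1 → ∀ n : ℕ,
      ‖rowGenFun (α : ℂ) β y n 1 / rowGenFun (α : ℂ) β 1 n 1 - Complex.exp ((y - 1) / 2)‖ ≤
        C / (n + β⁻¹) := by
  have hb : 0 < β⁻¹ := inv_pos.2 hβ
  have hβ' : (β : ℂ) ≠ 0 := by exact_mod_cast hβ.ne'
  have hx : (β : ℂ) * ((β⁻¹ : ℝ) : ℂ) = 1 := by push_cast; exact mul_inv_cancel₀ hβ'
  obtain ⟨C, hC⟩ := exists_norm_sub_approx_le (inv_pos.2 hα) hb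
  refine ⟨C + 6 * β⁻¹, fun y hy n => ?_⟩
  have hz : ‖y - 1‖ ≤ 2 := (norm_sub_le _ _).trans (by rw [norm_one]; linarith)
  have h1 := hC (y - 1) hz _ (isNormalizedSolution_rowGenFun hα hβ y hb) n β⁻¹ le_rfl
  simp only [← rowGenFun_at_one hα, hx] at h1
  have hn : (0 : ℝ) ≤ n := n.cast_nonneg
  have hr : β⁻¹ / (n + β⁻¹) ≤ 1 := div_le_one_of_le₀ (by linarith) (by positivity)
  have hr0 : 0 ≤ β⁻¹ / (n + β⁻¹) := by positivity
  have hr2 : |(0 : ℝ) ^ 2 / 1 ^ 2 - β⁻¹ ^ 2 / (n + β⁻¹) ^ 2| ≤ β⁻¹ / (n + β⁻¹) := by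
    rw [zero_pow two_ne_zero, zero_div, zero_sub, abs_neg, ← div_pow, abs_of_nonneg (sq_nonneg _)]
    exact pow_le_of_le_one hr0 hr two_ne_zero
  have h2 := norm_approx_sub_approx_le hz (s := n + β⁻¹) (t := β⁻¹) le_rfl zero_le_one
    (hr2.trans hr)
  have h3 : approx (y - 1) 1 0 = Complex.exp ((y - 1) / 2) := by simp [approx]
  rw [h3] at h2
  refine (norm_sub_le_norm_sub_add_norm_sub _ (approx (y - 1) (n + β⁻¹) β⁻¹) _).trans ?_
  rw [add_div, mul_div_assoc]
  linarith

section Probability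

variable {n : ℕ}

theorem ncard_eq_card {S : ℕ → ℕ → StairSymb} (hS : IsStaircase n S) {c : StairSymb}
    (hc : c ≠ empty) :
    Set.ncard {p : ℕ × ℕ | S p.1 p.2 = c} =
      #{p ∈ range n ×ˢ range n | S (p.2 + 1) (p.1 + 1) = c} := by
  have hinj : Function.Injective fun p : ℕ × ℕ => (p.2 + 1, p.1 + 1) := by
    rintro ⟨a, b⟩ ⟨c, d⟩ h
    simp only [Prod.mk.injEq] at h ⊢
    omega
  rw [← card_image_of_injective _ hinj, ← Set.ncard_coe_finset]
  congr 1
  ext ⟨i, j⟩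
  simp only [Set.mem_ofPred_eq, coe_image, Set.mem_image, mem_coe, mem_filter, mem_product,
    mem_range, Prod.mk.injEq, Prod.exists]
  constructor
  · intro h
    have hij : 1 ≤ i ∧ 1 ≤ j ∧ i + j ≤ n + 1 := by
      by_contra hij
      exact hc (h.symm.trans (hS.1 i j hij))
    refine ⟨j - 1, i - 1, ⟨⟨by omega, by omega⟩, ?_⟩, by omega, by omega⟩
    rwa [Nat.sub_add_cancel hij.1, Nat.sub_add_cancel hij.2.1]
  · rintro ⟨a, b, ⟨_, h⟩, rfl, rfl⟩
    exact h

theorem prod_weight_eq_stairWt (α β : ℝ) {S : ℕ → ℕ → StairSymb} (hS : IsStaircase n S) :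
    ∏ j ∈ range n, ∏ i ∈ range n, (S (i + 1) (j + 1)).weight (α : ℂ) β = stairWt α β S := by
  have hw : ∀ c : StairSymb, c.weight (α : ℂ) β =
      (if c = alpha then (α : ℂ) else 1) * (if c = beta then (β : ℂ) else 1) := by
    rintro (_ | _ | _) <;> simp [weight]
  rw [stairWt, ncard_eq_card hS (by simp), ncard_eq_card hS (by simp), ← prod_product']
  simp only [hw, prod_mul_distrib, prod_ite, prod_const, one_pow, mul_one]
  push_cast
  rfl

theorem rowGenFun_one_eq_sum (α β : ℝ) (y : ℂ) (n : ℕ) :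
    rowGenFun (α : ℂ) β y n 1 = ∑ S ∈ tableaux n, (stairWt α β S : ℂ) * y ^ thirdCount n S := by
  refine sum_congr rfl fun S hS => ?_
  rw [markedWeight, prod_weight_eq_stairWt α β (mem_tableaux.1 hS), prod_const_one, mul_one]

theorem stairZ_eq_sum (α β : ℝ) (n : ℕ) : stairZ n α β = ∑ S ∈ tableaux n, stairWt α β S := by
  have : {S : ℕ → ℕ → StairSymb | IsStaircase n S} = tableaux n := by
    ext S; simp [mem_tableaux]
  rw [stairZ, this, finsum_mem_coe_finset]

open Classical in
theorem stairP_eq_sum_div (α β : ℝ) (n : ℕ) (E : (ℕ → ℕ → StairSymb) → Prop) :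
    stairP n α β E = (∑ S ∈ tableaux n with E S, stairWt α β S) / stairZ n α β := by
  have : {S : ℕ → ℕ → StairSymb | IsStaircase n S ∧ E S} =
      ({S ∈ tableaux n | E S} : Finset (ℕ → ℕ → StairSymb)) := by
    ext S; simp [mem_tableaux]
  rw [stairP, this, finsum_mem_coe_finset]

theorem ofReal_stairZ (α β : ℝ) (n : ℕ) : (stairZ n α β : ℂ) = rowGenFun (α : ℂ) β 1 n 1 := by
  simp [stairZ_eq_sum, rowGenFun_one_eq_sum]

/-- The probability generating function of the third diagonal is the generating function of the
point probabilities. -/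
theorem iteratedDeriv_rowGenFun_div (α β : ℝ) (n k : ℕ) :
    iteratedDeriv k (fun y : ℂ => rowGenFun (α : ℂ) β y n 1 / rowGenFun (α : ℂ) β 1 n 1) 0 =
      k.factorial * (stairP n α β fun S => thirdCount n S = k : ℝ) := by
  classical
  have e : (fun y : ℂ => rowGenFun (α : ℂ) β y n 1 / rowGenFun (α : ℂ) β 1 n 1) = fun y =>
      ∑ S ∈ tableaux n, (stairWt α β S / stairZ n α β : ℂ) * y ^ thirdCount n S := by
    funext y
    rw [rowGenFun_one_eq_sum α β y, ← ofReal_stairZ, sum_div]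
    exact sum_congr rfl fun S _ => by ring
  rw [e, iteratedDeriv_fun_sum fun S _ => by fun_prop, stairP_eq_sum_div, sum_filter]
  push_cast
  rw [sum_div, mul_sum]
  refine sum_congr rfl fun S _ => ?_
  rw [iteratedDeriv_const_mul_field, iteratedDeriv_fun_pow_zero]
  by_cases h : k = thirdCount n S
  · rw [if_pos h, if_pos h.symm, h]; ring
  · rw [if_neg h, if_neg (Ne.symm h)]; simp

theorem exists_abs_stairP_sub_le {α β : ℝ} (hα : 0 < α) (hβ : 0 < β) :
    ∃ C, ∀ k n : ℕ, |stairP n α β (fun S => thirdCount n S = k) -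
      Real.exp (-(1 / 2)) * (1 / 2) ^ k / k.factorial| ≤ C / (n + β⁻¹) := by
  obtain ⟨C, hC⟩ := exists_norm_rowGenFun_sub_exp_le hα hβ
  refine ⟨C, fun k n => ?_⟩
  set f : ℂ → ℂ := fun y => rowGenFun (α : ℂ) β y n 1 / rowGenFun (α : ℂ) β 1 n 1
  set g : ℂ → ℂ := fun y => Complex.exp (-(1 / 2)) * Complex.exp (1 / 2 * y) with hg
  have hexp : ∀ y : ℂ, Complex.exp ((y - 1) / 2) = g y := fun y => by
    simp only [hg, ← Complex.exp_add]; congr 1; ring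
  have hf : ContDiff ℂ ⊤ f := by
    simp only [f, rowGenFun_one_eq_sum α β]
    fun_prop
  have hg' : ContDiff ℂ ⊤ g := by fun_prop
  have h := Complex.norm_iteratedDeriv_le_of_forall_mem_sphere_norm_le (c := 0) (f := f - g) k
    one_pos ((hf.sub hg').differentiable (by simp)).diffContOnCl (C := C / (n + β⁻¹)) fun y hy => by
      have := hC y (mem_sphere_zero_iff_norm.1 hy).le n
      rwa [hexp] at this
  have e : iteratedDeriv k (f - g) 0 =
      ((k.factorial * (stairP n α β (fun S => thirdCount n S = k) -
        Real.exp (-(1 / 2)) * (1 / 2) ^ k / k.factorial) : ℝ) : ℂ) := by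
    have hk : (k.factorial : ℂ) ≠ 0 := by exact_mod_cast k.factorial_ne_zero
    rw [iteratedDeriv_sub (hf.of_le le_top).contDiffAt (hg'.of_le le_top).contDiffAt,
      iteratedDeriv_rowGenFun_div, hg, iteratedDeriv_const_mul_field,
      iteratedDeriv_cexp_const_mul]
    push_cast
    simp only [mul_zero, Complex.exp_zero, mul_one]
    field_simp
  have hk : (0 : ℝ) < k.factorial := by exact_mod_cast k.factorial_pos
  rw [e, Complex.norm_real, Real.norm_eq_abs, abs_mul, abs_of_pos hk, one_pow, div_one] at h
  exact le_of_mul_le_mul_left h hk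

end Probability

end Staircase

/-- The number `A_n^{(3)}` of α's on the third main diagonal converges in distribution
to `Pois(1/2)`. -/
theorem alphas_third_diagonal_poisson
    (α β : ℝ) (hα : 0 < α) (hβ : 0 < β) (k : ℕ) :
    Filter.Tendsto (fun n : ℕ =>
        stairP n α β (fun S =>
          (((Finset.Icc 1 (n - 2)).filter
            (fun j => S (n - j - 1) j = StairSymb.alpha)).card) = k))
      Filter.atTop
      (nhds (Real.exp (-(1 / 2 : ℝ)) * (1 / 2 : ℝ) ^ k / (Nat.factorial k : ℝ))) := by
  obtain ⟨C, hC⟩ := Staircase.exists_abs_stairP_sub_le hα hβ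
  refine tendsto_iff_norm_sub_tendsto_zero.2 (squeeze_zero (fun _ => norm_nonneg _) (hC k) ?_)
  exact Filter.Tendsto.div_atTop tendsto_const_nhds
    (Filter.tendsto_atTop_add_const_right _ _ tendsto_natCast_atTop_atTop)
end

section
/- Let n ≥ 3, let α, β > 0, let r ≥ 1, and let 3 ≤ j_1 < ⋯ < j_r ≤ n−2. Then the probability under ℙ_{n,α,β} of the event that every box (n−j_l−1, j_l), l = 1, …, r, is nonempty, box (n−1,1) is empty, and box (n,1) contains β, equals the probability under ℙ_{n,α,β} of the event that every box (n−j_l−1, j_l), l = 1, …, r, is nonempty and box (n−1,2) contains β. -/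
open scoped BigOperators

/-- The involution of the cells exchanging the first two columns in the rows above row `n - 1`,
and exchanging the two bottom cells `(n, 1)` and `(n - 1, 2)` of these columns. -/
def swapCell (n : ℕ) (p : ℕ × ℕ) : ℕ × ℕ :=
  if p.1 + 2 ≤ n ∧ p.2 = 1 then (p.1, 2)
  else if p.1 + 2 ≤ n ∧ p.2 = 2 then (p.1, 1)
  else if p.1 = n ∧ p.2 = 1 then (n - 1, 2)
  else if p.1 = n - 1 ∧ p.2 = 2 then (n, 1)
  else p

lemma swapCell_involutive {n : ℕ} (hn : 2 ≤ n) : Function.Involutive (swapCell n) := by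
  rintro ⟨a, b⟩
  simp only [swapCell]
  split_ifs <;> simp_all <;> omega

/-- The filling obtained by exchanging the first two columns along `swapCell`. -/
def swapFilling (n : ℕ) (S : ℕ → ℕ → StairSymb) : ℕ → ℕ → StairSymb :=
  fun i j => S (swapCell n (i, j)).1 (swapCell n (i, j)).2

lemma swapFilling_swapFilling {n : ℕ} (hn : 2 ≤ n) (S : ℕ → ℕ → StairSymb) :
    swapFilling n (swapFilling n S) = S := by
  funext i j
  simp [swapFilling, swapCell_involutive hn (i, j)]

section values

variable {n i j : ℕ} (S : ℕ → ℕ → StairSymb)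

lemma swapFilling_upper_one (hi : i + 2 ≤ n) : swapFilling n S i 1 = S i 2 := by
  simp [swapFilling, swapCell, hi]

lemma swapFilling_upper_two (hi : i + 2 ≤ n) : swapFilling n S i 2 = S i 1 := by
  simp [swapFilling, swapCell, hi]

lemma swapFilling_bottom_one : swapFilling n S n 1 = S (n - 1) 2 := by
  simp [swapFilling, swapCell]

lemma swapFilling_bottom_two (hn : 2 ≤ n) : swapFilling n S (n - 1) 2 = S n 1 := by
  have : ¬ (n - 1 + 2 ≤ n) := by omega
  simp [swapFilling, swapCell, this]

lemma swapFilling_of_ne (h1 : ¬ (i + 2 ≤ n ∧ (j = 1 ∨ j = 2))) (h2 : ¬ (i = n ∧ j = 1))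
    (h3 : ¬ (i = n - 1 ∧ j = 2)) : swapFilling n S i j = S i j := by
  have h4 : ¬ (i + 2 ≤ n ∧ j = 1) := by tauto
  have h5 : ¬ (i + 2 ≤ n ∧ j = 2) := by tauto
  simp only [swapFilling, swapCell, if_neg h2, if_neg h3, if_neg h4, if_neg h5]

end values

lemma ncard_swapFilling {n : ℕ} (hn : 2 ≤ n) (S : ℕ → ℕ → StairSymb) (s : StairSymb) :
    Set.ncard {p : ℕ × ℕ | swapFilling n S p.1 p.2 = s} =
      Set.ncard {p : ℕ × ℕ | S p.1 p.2 = s} := by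
  have hinv := swapCell_involutive hn
  rw [← Set.ncard_image_of_injective {p : ℕ × ℕ | S p.1 p.2 = s} hinv.injective,
    Set.image_eq_preimage_of_inverse hinv.leftInverse hinv.rightInverse]
  rfl

lemma stairWt_swapFilling {n : ℕ} (hn : 2 ≤ n) (α β : ℝ) (S : ℕ → ℕ → StairSymb) :
    stairWt α β (swapFilling n S) = stairWt α β S := by
  simp only [stairWt, ncard_swapFilling hn]

/-- Exchanging the first two columns preserves staircase tableaux, provided one of these columns
is empty above its bottom cell and the cell `(n - 1, 1)` is empty. -/
lemma IsStaircase.swapFilling {n : ℕ} (hn : 2 ≤ n) {S : ℕ → ℕ → StairSymb}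
    (hS : IsStaircase n S) (hc : S (n - 1) 1 = StairSymb.empty)
    (hcol : (∀ i, i + 2 ≤ n → S i 1 = StairSymb.empty) ∨
      ∀ i, i + 2 ≤ n → S i 2 = StairSymb.empty) :
    IsStaircase n (swapFilling n S) := by
  obtain ⟨hout, hA, hB, hdiag⟩ := hS
  have hc' : _root_.swapFilling n S (n - 1) 1 = StairSymb.empty := by
    rwa [swapFilling_of_ne S (by omega) (by omega) (by omega)]
  refine ⟨fun i j h => ?_, fun i i' j hi hii hj hij h => ?_, fun i j j' hi hj hjj hij h => ?_,
    fun i j hi hj hij => ?_⟩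
  · by_cases h1 : i + 2 ≤ n ∧ (j = 1 ∨ j = 2)
    · obtain ⟨h1, rfl | rfl⟩ := h1
      · rw [swapFilling_upper_one S h1]
        exact hout _ _ (by omega)
      · rw [swapFilling_upper_two S h1]
        exact hout _ _ (by omega)
    · rw [swapFilling_of_ne S h1 (by omega) (by omega)]
      exact hout _ _ h
  · by_cases hj1 : j = 1
    · subst hj1
      obtain hi' | rfl | rfl : i' + 2 ≤ n ∨ i' = n - 1 ∨ i' = n := by omega
      · rw [swapFilling_upper_one S hi'] at h
        rw [swapFilling_upper_one S (by omega)]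
        exact hA i i' 2 hi hii (by omega) (by omega) h
      · simp [hc'] at h
      · rw [swapFilling_bottom_one] at h
        obtain hi2 | rfl : i + 2 ≤ i' ∨ i = i' - 1 := by omega
        · rw [swapFilling_upper_one S hi2]
          exact hA i (i' - 1) 2 hi (by omega) (by omega) (by omega) h
        · exact hc'
    by_cases hj2 : j = 2
    · subst hj2
      rw [swapFilling_upper_two S (by omega)]
      obtain hi' | rfl : i' + 2 ≤ n ∨ i' = n - 1 := by omega
      · rw [swapFilling_upper_two S hi'] at h
        exact hA i i' 1 hi hii (by omega) (by omega) h
      · rw [swapFilling_bottom_two S hn] at h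
        exact hA i n 1 hi (by omega) (by omega) (by omega) h
    rw [swapFilling_of_ne S (by omega) (by omega) (by omega)] at h ⊢
    exact hA i i' j hi hii hj hij h
  · by_cases hj2 : j' = 2
    · obtain rfl : j = 1 := by omega
      subst hj2
      obtain hi2 | rfl : i + 2 ≤ n ∨ i = n - 1 := by omega
      · rw [swapFilling_upper_two S hi2] at h
        rw [swapFilling_upper_one S hi2]
        obtain h1 | h2 := hcol
        · simp [h1 i hi2] at h
        · exact h2 i hi2
      · exact hc'
    · rw [swapFilling_of_ne S (by omega) (by omega) (by omega)] at h
      by_cases h1 : j = 1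
      · subst h1
        rw [swapFilling_upper_one S (by omega)]
        exact hB i 2 j' hi (by omega) (by omega) hij h
      by_cases h2 : j = 2
      · subst h2
        rw [swapFilling_upper_two S (by omega)]
        exact hB i 1 j' hi (by omega) (by omega) hij h
      rw [swapFilling_of_ne S (by omega) (by omega) (by omega)]
      exact hB i j j' hi hj hjj hij h
  · by_cases h1 : j = 1
    · subst h1
      obtain rfl : i = n := by omega
      rw [swapFilling_bottom_one]
      exact hdiag _ _ (by omega) (by omega) (by omega)
    by_cases h2 : j = 2
    · subst h2
      obtain rfl : i = n - 1 := by omega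
      rw [swapFilling_bottom_two S hn]
      exact hdiag _ _ (by omega) (by omega) (by omega)
    rw [swapFilling_of_ne S (by omega) (by omega) (by omega)]
    exact hdiag i j hi hj hij

/-- Exchange the first two columns when their bottom cells differ. -/
def switchFilling (n : ℕ) (S : ℕ → ℕ → StairSymb) : ℕ → ℕ → StairSymb :=
  if S n 1 = S (n - 1) 2 then S else swapFilling n S

lemma switchFilling_switchFilling {n : ℕ} (hn : 2 ≤ n) (S : ℕ → ℕ → StairSymb) :
    switchFilling n (switchFilling n S) = S := by
  by_cases h : S n 1 = S (n - 1) 2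
  · simp [switchFilling, h]
  · simp [switchFilling, h, swapFilling_bottom_one, swapFilling_bottom_two S hn, Ne.symm h,
      swapFilling_swapFilling hn]

lemma stairWt_switchFilling {n : ℕ} (hn : 2 ≤ n) (α β : ℝ) (S : ℕ → ℕ → StairSymb) :
    stairWt α β (switchFilling n S) = stairWt α β S := by
  unfold switchFilling
  split_ifs
  · rfl
  · exact stairWt_swapFilling hn α β S

lemma switchFilling_of_three_le {n i j : ℕ} (hj : 3 ≤ j) (S : ℕ → ℕ → StairSymb) :
    switchFilling n S i j = S i j := by
  unfold switchFilling
  split_ifs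
  · rfl
  · exact swapFilling_of_ne S (by omega) (by omega) (by omega)

lemma IsStaircase.eq_empty_above_alpha {n : ℕ} {S : ℕ → ℕ → StairSymb} (hS : IsStaircase n S)
    {i i' j : ℕ} (h : S i' j = StairSymb.alpha) (hii : i < i') : S i j = StairSymb.empty := by
  by_cases hi : 1 ≤ i ∧ 1 ≤ j ∧ i + j ≤ n + 1
  · refine hS.2.1 i i' j hi.1 hii hi.2.1 ?_ h
    by_contra hlt
    have := hS.1 i' j (by omega)
    simp [this] at h
  · exact hS.1 i j hi

lemma IsStaircase.switchFilling_of_left {n : ℕ} (hn : 2 ≤ n) {S : ℕ → ℕ → StairSymb}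
    (hS : IsStaircase n S) (h1 : S (n - 1) 1 = StairSymb.empty) (h2 : S n 1 = StairSymb.beta) :
    IsStaircase n (switchFilling n S) ∧ switchFilling n S (n - 1) 2 = StairSymb.beta := by
  unfold switchFilling
  split_ifs with h
  · exact ⟨hS, h ▸ h2⟩
  · have hα : S (n - 1) 2 = StairSymb.alpha := by
      have := hS.2.2.2 (n - 1) 2 (by omega) (by omega) (by omega)
      cases hs : S (n - 1) 2 <;> simp_all
    exact ⟨hS.swapFilling hn h1 (.inr fun i hi => hS.eq_empty_above_alpha hα (by omega)),
      by rwa [swapFilling_bottom_two S hn]⟩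

lemma IsStaircase.switchFilling_of_right {n : ℕ} (hn : 2 ≤ n) {S : ℕ → ℕ → StairSymb}
    (hS : IsStaircase n S) (h2 : S (n - 1) 2 = StairSymb.beta) :
    IsStaircase n (switchFilling n S) ∧ switchFilling n S (n - 1) 1 = StairSymb.empty ∧
      switchFilling n S n 1 = StairSymb.beta := by
  have h1 : S (n - 1) 1 = StairSymb.empty :=
    hS.2.2.1 (n - 1) 1 2 (by omega) (by omega) (by omega) (by omega) h2
  unfold switchFilling
  split_ifs with h
  · exact ⟨hS, h1, h ▸ h2⟩
  · have hα : S n 1 = StairSymb.alpha := by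
      have := hS.2.2.2 n 1 (by omega) (by omega) (by omega)
      cases hs : S n 1 <;> simp_all
    refine ⟨hS.swapFilling hn h1 (.inl fun i hi => hS.eq_empty_above_alpha hα (by omega)), ?_, ?_⟩
    · rwa [swapFilling_of_ne S (by omega) (by omega) (by omega)]
    · rwa [swapFilling_bottom_one]

/-- Switching lemma: for columns `j_1, …, j_r ≥ 3` on the third main diagonal, the event
"all chosen boxes nonempty, box `(n−1,1)` empty, box `(n,1)` contains β" has the same
probability as "all chosen boxes nonempty and box `(n−1,2)` contains β". -/
theorem switch_beta_third_diagonal (n : ℕ) (hn : 3 ≤ n) (α β : ℝ) (hα : 0 < α) (hβ : 0 < β)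
    (r : ℕ) (hr : 1 ≤ r) (j : Fin r → ℕ)
    (hj1 : ∀ l, 3 ≤ j l) (hjn : ∀ l, j l ≤ n - 2) (hmono : StrictMono j) :
    stairP n α β (fun S => (∀ l : Fin r, S (n - j l - 1) (j l) ≠ StairSymb.empty) ∧
        S (n - 1) 1 = StairSymb.empty ∧ S n 1 = StairSymb.beta)
      = stairP n α β (fun S => (∀ l : Fin r, S (n - j l - 1) (j l) ≠ StairSymb.empty) ∧
          S (n - 1) 2 = StairSymb.beta) := by
  have hn2 : 2 ≤ n := by omega
  unfold stairP
  congr 1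
  refine finsum_mem_eq_of_bijOn (switchFilling n) (Set.InvOn.bijOn (f' := switchFilling n)
    ⟨fun S _ => switchFilling_switchFilling hn2 S, fun S _ => switchFilling_switchFilling hn2 S⟩
    ?_ ?_) fun S _ => (stairWt_switchFilling hn2 α β S).symm
  · rintro S ⟨hS, hbox, h1, h2⟩
    obtain ⟨hT, hβ2⟩ := hS.switchFilling_of_left hn2 h1 h2
    exact ⟨hT, fun l => by rw [switchFilling_of_three_le (hj1 l)]; exact hbox l, hβ2⟩
  · rintro S ⟨hS, hbox, h2⟩
    obtain ⟨hT, he, hβ1⟩ := hS.switchFilling_of_right hn2 h2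
    exact ⟨hT, fun l => by rw [switchFilling_of_three_le (hj1 l)]; exact hbox l, he, hβ1⟩
end

section
/- For every integer r ≥ 1 there exists a constant C > 0 such that for all n ≥ 3, all α, β > 0 with a = 1/α and b = 1/β, and all 1 ≤ j_1 < ⋯ < j_r ≤ n−2 satisfying j_{l+1} ≥ j_l + 3 for all l = 1, …, r−1, the probability under ℙ_{n,α,β} that, for every l = 1, …, r, the box (n−j_l−1, j_l) is nonempty differs from ∏_{l=1}^r 1/(n+a+b−l) by at most C/(n+a+b)^{r+1} in absolute value. -/
open scoped BigOperators

/-- Admissible fillings of a column whose entries outside the rows `F` are forced to be empty. -/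
noncomputable def stairCols (F : Finset ℕ) : Finset (ℕ → StairSymb) := by
  classical
  exact (Set.Finite.subset (Set.finite_range
    (fun (g : F → Fin 3) (i : ℕ) => if h : i ∈ F then
      (if g ⟨i, h⟩ = 0 then StairSymb.empty else if g ⟨i, h⟩ = 1 then StairSymb.alpha
        else StairSymb.beta) else StairSymb.empty))
    (t := {c : ℕ → StairSymb | (∀ i, i ∉ F → c i = StairSymb.empty) ∧
      ∀ i i' : ℕ, i < i' → c i' = StairSymb.alpha → c i = StairSymb.empty}) (by
    rintro c ⟨h1, -⟩
    refine ⟨fun i => match c i with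
      | .empty => 0
      | .alpha => 1
      | .beta => 2, ?_⟩
    funext i
    by_cases hi : i ∈ F
    · cases hc : c i <;> simp [hi, hc]
    · simp [hi, h1 i hi])).toFinset

theorem mem_stairCols {F : Finset ℕ} {c : ℕ → StairSymb} :
    c ∈ stairCols F ↔ (∀ i, i ∉ F → c i = StairSymb.empty) ∧
      ∀ i i', i < i' → c i' = StairSymb.alpha → c i = StairSymb.empty := by
  simp [stairCols]

/-- The column whose only nonempty entry is an `α` in row `M`. -/
def alphaCol (M : ℕ) : ℕ → StairSymb :=
  Function.update (fun _ => StairSymb.empty) M StairSymb.alpha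

theorem sum_stairCols_insert {F : Finset ℕ} {M : ℕ} (hM : ∀ i ∈ F, i < M)
    (f : (ℕ → StairSymb) → ℝ) :
    ∑ c ∈ stairCols (insert M F), f c =
      ∑ c ∈ stairCols F, f c + ∑ c ∈ stairCols F, f (Function.update c M StairSymb.beta)
        + f (alphaCol M) := by
  classical
  have hMF : M ∉ F := fun h => lt_irrefl _ (hM M h)
  have hinj : Set.InjOn (fun c : ℕ → StairSymb => Function.update c M StairSymb.beta)
      (stairCols F) := by
    intro c hc c' hc' h
    funext i
    by_cases hi : i = M
    · subst hi
      rw [(mem_stairCols.1 hc).1 _ hMF, (mem_stairCols.1 hc').1 _ hMF]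
    · simpa [hi] using congrFun h i
  have key : stairCols (insert M F) =
      (stairCols F ∪ (stairCols F).image (fun c => Function.update c M StairSymb.beta))
        ∪ {alphaCol M} := by
    ext c
    simp only [Finset.mem_union, Finset.mem_image, Finset.mem_singleton]
    constructor
    · intro hc
      obtain ⟨h1, h2⟩ := mem_stairCols.1 hc
      cases h : c M with
      | empty =>
        refine Or.inl (Or.inl (mem_stairCols.2 ⟨fun i hi => ?_, h2⟩))
        by_cases hiM : i = M
        · rw [hiM, h]
        · exact h1 i (by simp [hiM, hi])
      | alpha =>
        right
        funext i
        rcases lt_trichotomy i M with hi | hi | hi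
        · simp [alphaCol, hi.ne, h2 i M hi h]
        · simp [alphaCol, hi, h]
        · have : i ∉ insert M F := by
            simp only [Finset.mem_insert, not_or]
            exact ⟨hi.ne', fun h' => absurd (hM i h') (by omega)⟩
          simp [alphaCol, hi.ne', h1 i this]
      | beta =>
        refine Or.inl (Or.inr ⟨Function.update c M StairSymb.empty,
          mem_stairCols.2 ⟨fun i hi => ?_, fun i i' hii h' => ?_⟩, ?_⟩)
        · by_cases hiM : i = M
          · simp [hiM]
          · simpa [hiM] using h1 i (by simp [hiM, hi])
        · have hi' : i' ≠ M := by rintro rfl; simp at h'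
          by_cases hiM : i = M
          · simp [hiM]
          · simp only [hi', ne_eq, not_false_eq_true, Function.update_of_ne] at h'
            simpa [hiM] using h2 i i' hii h'
        · rw [Function.update_idem, ← h, Function.update_eq_self]
    · rintro ((hc | ⟨c, hc, rfl⟩) | rfl)
      · obtain ⟨h1, h2⟩ := mem_stairCols.1 hc
        exact mem_stairCols.2 ⟨fun i hi => h1 i fun h => hi (by simp [h]), h2⟩
      · obtain ⟨h1, h2⟩ := mem_stairCols.1 hc
        refine mem_stairCols.2 ⟨fun i hi => ?_, fun i i' hii h' => ?_⟩
        · simp only [Finset.mem_insert, not_or] at hi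
          simpa [hi.1] using h1 i hi.2
        · have hi' : i' ≠ M := by rintro rfl; simp at h'
          simp only [hi', ne_eq, not_false_eq_true, Function.update_of_ne] at h'
          have hiM : i ≠ M := by
            rintro rfl
            have : i' ∈ F := by
              by_contra hc
              rw [h1 _ hc] at h'
              cases h'
            have := hM _ this
            omega
          simpa [hiM] using h2 i i' hii h'
      · refine mem_stairCols.2 ⟨fun i hi => ?_, fun i i' hii h' => ?_⟩
        · simp only [Finset.mem_insert, not_or] at hi
          simp [alphaCol, hi.1]
        · have : i' = M := by
            by_contra hc
            simp [alphaCol, hc] at h'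
          subst this
          simp [alphaCol, hii.ne]
  have hd1 : Disjoint (stairCols F)
      ((stairCols F).image (fun c => Function.update c M StairSymb.beta)) := by
    rw [Finset.disjoint_left]
    rintro c hc hc'
    obtain ⟨c', -, rfl⟩ := Finset.mem_image.1 hc'
    have := (mem_stairCols.1 hc).1 M hMF
    simp at this
  have hd2 : Disjoint (stairCols F ∪
      (stairCols F).image (fun c => Function.update c M StairSymb.beta)) {alphaCol M} := by
    rw [Finset.disjoint_singleton_right]
    intro h
    rcases Finset.mem_union.1 h with h | h
    · have := (mem_stairCols.1 h).1 M hMF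
      simp [alphaCol] at this
    · obtain ⟨c', -, h'⟩ := Finset.mem_image.1 h
      have := congrFun h' M
      simp [alphaCol] at this
  rw [key, Finset.sum_union hd2, Finset.sum_union hd1, Finset.sum_image hinj,
    Finset.sum_singleton]

/-- The weight of a single symbol. -/
def symbWt (α β : ℝ) : StairSymb → ℝ
  | .empty => 1
  | .alpha => α
  | .beta => β

/-- The rows in `F` in which the column `c` has no `β`. -/
def betaFree (F : Finset ℕ) (c : ℕ → StairSymb) : Finset ℕ := {i ∈ F | c i ≠ StairSymb.beta}

/-- Weighted sum of `φ (betaFree F c)` over the columns `c` satisfying `E`. -/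
noncomputable def colSum (α β : ℝ) (F : Finset ℕ) (E : (ℕ → StairSymb) → Prop)
    (φ : Finset ℕ → ℝ) : ℝ := by
  classical
  exact ∑ c ∈ stairCols F, if E c then (∏ i ∈ F, symbWt α β (c i)) * φ (betaFree F c) else 0

theorem betaFree_subset (F : Finset ℕ) (c : ℕ → StairSymb) : betaFree F c ⊆ F :=
  Finset.filter_subset _ _

theorem colSum_insert (α β : ℝ) {F : Finset ℕ} {M : ℕ} (hM : ∀ i ∈ F, i < M)
    (E : (ℕ → StairSymb) → Prop) (φ : Finset ℕ → ℝ) [Decidable (E (alphaCol M))] :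
    colSum α β (insert M F) E φ =
      colSum α β F E (fun G => φ (insert M G))
      + β * colSum α β F (fun c => E (Function.update c M StairSymb.beta)) φ
      + if E (alphaCol M) then α * φ (insert M F) else 0 := by
  classical
  have hMF : M ∉ F := fun h => lt_irrefl _ (hM M h)
  have hne : ∀ i ∈ F, i ≠ M := fun i hi h => hMF (h ▸ hi)
  unfold colSum
  rw [sum_stairCols_insert hM]
  congr 1
  · congr 1
    · refine Finset.sum_congr rfl fun c hc => ?_
      have h0 := (mem_stairCols.1 hc).1 M hMF
      have : betaFree (insert M F) c = insert M (betaFree F c) := by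
        simp [betaFree, Finset.filter_insert, h0]
      rw [this, Finset.prod_insert hMF, h0]
      simp [symbWt]
    · rw [Finset.mul_sum]
      refine Finset.sum_congr rfl fun c hc => ?_
      have : betaFree (insert M F) (Function.update c M StairSymb.beta) = betaFree F c := by
        simp only [betaFree, Finset.filter_insert, Function.update_self]
        simp only [ne_eq, not_true_eq_false, if_false]
        exact Finset.filter_congr fun i hi => by simp [hne i hi]
      rw [this, Finset.prod_insert hMF,
        Finset.prod_congr rfl (fun i hi => by rw [Function.update_of_ne (hne i hi)])]
      simp only [Function.update_self, symbWt, mul_ite, mul_zero]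
      congr 1
      ring
  · have : betaFree (insert M F) (alphaCol M) = insert M F := by
      refine Finset.filter_true_of_mem fun i _ => ?_
      by_cases h : i = M <;> simp [alphaCol, h]
    rw [this, Finset.prod_insert hMF,
      Finset.prod_eq_one (s := F) (fun i hi => by simp [alphaCol, hne i hi, symbWt])]
    rw [show alphaCol M M = StairSymb.alpha by simp [alphaCol]]
    simp only [symbWt, mul_one]

theorem colSum_congr (α β : ℝ) {F : Finset ℕ} {E E' : (ℕ → StairSymb) → Prop}
    {φ φ' : Finset ℕ → ℝ} (hE : ∀ c ∈ stairCols F, E c ↔ E' c) (hφ : ∀ G ⊆ F, φ G = φ' G) :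
    colSum α β F E φ = colSum α β F E' φ' := by
  classical
  refine Finset.sum_congr rfl fun c hc => ?_
  rw [hφ _ (betaFree_subset F c)]
  simp only [hE c hc]

theorem colSum_const_mul (α β x : ℝ) (F : Finset ℕ) (E : (ℕ → StairSymb) → Prop)
    (φ : Finset ℕ → ℝ) :
    colSum α β F E (fun G => x * φ G) = x * colSum α β F E φ := by
  classical
  unfold colSum
  rw [Finset.mul_sum]
  refine Finset.sum_congr rfl fun c _ => ?_
  rw [mul_ite, mul_zero]
  congr 1
  ring

theorem colSum_eq_zero_of_forall (α β : ℝ) {F : Finset ℕ} {E : (ℕ → StairSymb) → Prop}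
    {φ : Finset ℕ → ℝ} (h : ∀ c ∈ stairCols F, E c → φ (betaFree F c) = 0) :
    colSum α β F E φ = 0 := by
  classical
  refine Finset.sum_eq_zero fun c hc => ?_
  split_ifs with hE
  · rw [h c hc hE, mul_zero]
  · rfl

theorem colSum_pow_card (α β z : ℝ) (F : Finset ℕ) :
    β * colSum α β F (fun _ => True) (fun G => z ^ G.card) =
      (α * z + β) * (z + β) ^ F.card - α * z * z ^ F.card := by
  classical
  refine Finset.induction_on_max F ?_ ?_
  · have : stairCols ∅ = {fun _ => StairSymb.empty} := by
      ext c
      simp only [mem_stairCols, Finset.mem_singleton]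
      constructor
      · rintro ⟨h, -⟩
        funext i
        exact h i (by simp)
      · rintro rfl
        simp
    simp [colSum, this, betaFree]
  · intro M F hM ih
    have hMF : M ∉ F := fun h => lt_irrefl _ (hM M h)
    rw [colSum_insert α β hM, colSum_congr (φ' := fun G => z * z ^ G.card) α β
      (fun _ _ => Iff.rfl), colSum_const_mul, if_pos trivial, Finset.card_insert_of_notMem hMF]
    · linear_combination (z + β) * ih
    · intro G hG
      rw [Finset.card_insert_of_notMem fun h => hMF (hG h), pow_succ']

/-- Transfer operator: adding a column on the left of a tableau of size `n` with set of
`β`-free rows `F`; the new column has to satisfy `E`. -/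
noncomputable def addCol (α β : ℝ) (n : ℕ) (E : (ℕ → StairSymb) → Prop)
    (φ : Finset ℕ → ℝ) (F : Finset ℕ) : ℝ :=
  colSum α β (insert (n + 1) F) (fun c => c (n + 1) ≠ StairSymb.empty ∧ E c) φ

theorem lt_of_subset_Icc {n : ℕ} {F : Finset ℕ} (hF : F ⊆ Finset.Icc 1 n) :
    ∀ i ∈ F, i < n + 1 := fun i hi => by
  have := Finset.mem_Icc.1 (hF hi)
  omega

theorem addCol_true (α β : ℝ) {n : ℕ} {F : Finset ℕ} (hF : F ⊆ Finset.Icc 1 n)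
    (φ : Finset ℕ → ℝ) :
    addCol α β n (fun _ => True) φ F =
      β * colSum α β F (fun _ => True) φ + α * φ (insert (n + 1) F) := by
  classical
  have hM := lt_of_subset_Icc hF
  have hMF : n + 1 ∉ F := fun h => lt_irrefl _ (hM _ h)
  rw [addCol, colSum_insert α β hM, colSum_eq_zero_of_forall, zero_add, if_pos]
  · simp
  · simp [alphaCol]
  · intro c hc h
    exact absurd ((mem_stairCols.1 hc).1 _ hMF) h.1

theorem addCol_pow_card (α β z : ℝ) {n : ℕ} {F : Finset ℕ} (hF : F ⊆ Finset.Icc 1 n) :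
    addCol α β n (fun _ => True) (fun G => z ^ G.card) F =
      (α * z + β) * (z + β) ^ F.card := by
  have hMF : n + 1 ∉ F := fun h => lt_irrefl _ (lt_of_subset_Icc hF _ h)
  rw [addCol_true α β hF, colSum_pow_card, Finset.card_insert_of_notMem hMF]
  ring

theorem addCol_pow_card_of_nonempty (α β z : ℝ) {n : ℕ} {F : Finset ℕ}
    (hF : F ⊆ Finset.Icc 1 (n + 2)) :
    addCol α β (n + 2) (fun c => c (n + 1) ≠ StairSymb.empty) (fun G => z ^ G.card) F =
      if n + 1 ∈ F then β * (α * z + β) * (z + β) ^ (F.erase (n + 1)).card else 0 := by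
  classical
  have hM := lt_of_subset_Icc hF
  have hMF : n + 2 + 1 ∉ F := fun h => lt_irrefl _ (hM _ h)
  have h1 : addCol α β (n + 2) (fun c => c (n + 1) ≠ StairSymb.empty) (fun G => z ^ G.card) F =
      β * colSum α β F (fun c => c (n + 1) ≠ StairSymb.empty) (fun G => z ^ G.card) := by
    rw [addCol, colSum_insert α β hM, colSum_eq_zero_of_forall, zero_add, if_neg, add_zero]
    · simp
    · simp [alphaCol]
    · intro c hc h
      exact absurd ((mem_stairCols.1 hc).1 _ hMF) h.1
  have h2 : ∀ F₀ : Finset ℕ, (∀ i ∈ F₀, i < n + 1) →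
      colSum α β (insert (n + 1) F₀) (fun c => c (n + 1) ≠ StairSymb.empty)
        (fun G => z ^ G.card) = (α * z + β) * (z + β) ^ F₀.card := by
    intro F₀ h₀
    have h₁ : n + 1 ∉ F₀ := fun h => lt_irrefl _ (h₀ _ h)
    rw [colSum_insert α β h₀, colSum_eq_zero_of_forall, zero_add, if_pos]
    · simp only [Function.update_self, ne_eq, reduceCtorEq, not_false_eq_true]
      rw [colSum_pow_card, Finset.card_insert_of_notMem h₁]
      ring
    · simp [alphaCol]
    · intro c hc h
      exact absurd ((mem_stairCols.1 hc).1 _ h₁) h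
  rw [h1]
  split_ifs with hp
  · set F₀ := F.filter (· < n + 1) with hF₀
    have h₀ : ∀ i ∈ F₀, i < n + 1 := fun i hi => (Finset.mem_filter.1 hi).2
    have h₁ : n + 1 ∉ F₀ := fun h => lt_irrefl _ (h₀ _ h)
    by_cases hq : n + 2 ∈ F
    · have hFe : F = insert (n + 2) (insert (n + 1) F₀) := by
        ext i
        simp only [hF₀, Finset.mem_insert, Finset.mem_filter]
        constructor
        · intro hi
          have := hM i hi
          by_cases i < n + 1
          · tauto
          · omega
        · rintro (rfl | rfl | h) <;> tauto
      have h₂ : ∀ i ∈ insert (n + 1) F₀, i < n + 2 := by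
        intro i hi
        rcases Finset.mem_insert.1 hi with rfl | hi
        · omega
        · have := h₀ i hi
          omega
      have h₃ : n + 2 ∉ insert (n + 1) F₀ := fun h => lt_irrefl _ (h₂ _ h)
      have h₄ : n + 2 ∉ F₀ := fun h => h₃ (by simp [h])
      have hE : (F.erase (n + 1)).card = F₀.card + 1 := by
        rw [Finset.card_erase_of_mem hp, hFe, Finset.card_insert_of_notMem h₃,
          Finset.card_insert_of_notMem h₁]
        omega
      rw [hE, hFe, colSum_insert α β h₂, colSum_congr (φ' := fun G => z * z ^ G.card) α β
        (fun _ _ => Iff.rfl), colSum_const_mul, if_neg, h2 F₀ h₀]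
      · simp only [ne_eq, show n + 1 ≠ n + 2 by omega, not_false_eq_true, Function.update_of_ne]
        have := h2 F₀ h₀
        simp only [ne_eq] at this
        rw [this]
        ring
      · simp [alphaCol]
      · intro G hG
        rw [Finset.card_insert_of_notMem fun h => h₃ (hG h), pow_succ']
    · have hFe : F = insert (n + 1) F₀ := by
        ext i
        simp only [hF₀, Finset.mem_insert, Finset.mem_filter]
        constructor
        · intro hi
          have := hM i hi
          by_cases i < n + 1
          · tauto
          · have : i ≠ n + 2 := by
              rintro rfl
              exact hq hi
            omega
        · rintro (rfl | h) <;> tauto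
      have hE : (F.erase (n + 1)).card = F₀.card := by
        rw [hFe, Finset.erase_insert h₁]
      rw [hE, hFe, h2 F₀ h₀]
      ring
  · rw [colSum_eq_zero_of_forall, mul_zero]
    intro c hc h
    exact absurd ((mem_stairCols.1 hc).1 _ hp) h

theorem addCol_indicator_mul_pow (α β w : ℝ) {n : ℕ} {F : Finset ℕ}
    (hF : F ⊆ Finset.Icc 1 (n + 1)) :
    addCol α β (n + 1) (fun _ => True)
      (fun G => if n + 1 ∈ G then w ^ (G.erase (n + 1)).card else 0) F =
      if n + 1 ∈ F then α * β * w ^ (F.erase (n + 1)).card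
        + (α * w + β) * (w + β) ^ (F.erase (n + 1)).card else 0 := by
  classical
  rw [addCol_true α β hF]
  have hM := lt_of_subset_Icc hF
  by_cases hp : n + 1 ∈ F
  · rw [if_pos hp]
    obtain ⟨F₀, hF₀, rfl⟩ : ∃ F₀, n + 1 ∉ F₀ ∧ F = insert (n + 1) F₀ :=
      ⟨F.erase (n + 1), by simp, (Finset.insert_erase hp).symm⟩
    have h₀ : ∀ i ∈ F₀, i < n + 1 := fun i hi => by
      have := hM i (by simp [hi])
      have : i ≠ n + 1 := by
        rintro rfl
        exact hF₀ hi
      omega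
    have h₂ : n + 2 ∉ F₀ := fun h => by
      have := h₀ _ h
      omega
    rw [if_pos (by simp), colSum_insert α β h₀,
      colSum_congr (F := F₀) (φ' := fun G => w ^ G.card) α β (fun _ _ => Iff.rfl),
      colSum_eq_zero_of_forall (F := F₀)
        (φ := fun G => if n + 1 ∈ G then w ^ (G.erase (n + 1)).card else 0), if_pos trivial,
      if_pos (by simp), Finset.erase_insert hF₀, Finset.erase_insert_of_ne (by omega),
      Finset.erase_insert hF₀, Finset.card_insert_of_notMem h₂]
    · linear_combination colSum_pow_card α β w F₀
    · intro c _ _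
      rw [if_neg]
      exact fun h => hF₀ (betaFree_subset _ _ h)
    · intro G hG
      have : n + 1 ∉ G := fun h => hF₀ (hG h)
      simp [this]
  · rw [if_neg hp, if_neg (by simp [hp]), colSum_eq_zero_of_forall]
    · simp
    · intro c _ _
      rw [if_neg]
      exact fun h => hp (betaFree_subset _ _ h)

theorem addCol_indicator_last (α β : ℝ) (g : ℕ → ℝ) {n : ℕ} {F : Finset ℕ}
    (hF : F ⊆ Finset.Icc 1 n) :
    addCol α β n (fun _ => True)
      (fun G => if n + 1 ∈ G then g (G.erase (n + 1)).card else 0) F = α * g F.card := by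
  have hM := lt_of_subset_Icc hF
  have hMF : n + 1 ∉ F := fun h => lt_irrefl _ (hM _ h)
  rw [addCol_true α β hF, if_pos (by simp), Finset.erase_insert hMF, colSum_eq_zero_of_forall]
  · ring
  · intro c _ _
    rw [if_neg]
    exact fun h => hMF (betaFree_subset _ _ h)

/-- The tableau with first column `c` and remaining columns those of `S`. -/
def consCol (S : ℕ → ℕ → StairSymb) (c : ℕ → StairSymb) : ℕ → ℕ → StairSymb
  | _, 0 => .empty
  | i, 1 => c i
  | i, j + 2 => S i (j + 1)

/-- The rows of a tableau of size `n` that contain no `β`. -/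
noncomputable def freeRows (n : ℕ) (S : ℕ → ℕ → StairSymb) : Finset ℕ := by
  classical
  exact {i ∈ Finset.Icc 1 n | ∀ j, S i j ≠ StairSymb.beta}

theorem mem_freeRows {n : ℕ} {S : ℕ → ℕ → StairSymb} {i : ℕ} :
    i ∈ freeRows n S ↔ (1 ≤ i ∧ i ≤ n) ∧ ∀ j, S i j ≠ StairSymb.beta := by
  simp [freeRows]

theorem freeRows_subset (n : ℕ) (S : ℕ → ℕ → StairSymb) : freeRows n S ⊆ Finset.Icc 1 n := by
  classical
  exact Finset.filter_subset _ _

theorem IsStaircase.col_zero {n : ℕ} {S : ℕ → ℕ → StairSymb} (h : IsStaircase n S) (i : ℕ) :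
    S i 0 = StairSymb.empty := h.1 i 0 (by omega)

theorem isStaircase_consCol {n : ℕ} {S : ℕ → ℕ → StairSymb} (hS : IsStaircase n S)
    {c : ℕ → StairSymb} (hc : c ∈ stairCols (insert (n + 1) (freeRows n S)))
    (hn : c (n + 1) ≠ StairSymb.empty) : IsStaircase (n + 1) (consCol S c) := by
  obtain ⟨h1, h2, h3, h4⟩ := hS
  obtain ⟨c1, c2⟩ := mem_stairCols.1 hc
  refine ⟨?_, ?_, ?_, ?_⟩
  · rintro i (_ | _ | j) h
    · rfl
    · refine c1 i fun hi => h ?_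
      rcases Finset.mem_insert.1 hi with rfl | hi
      · omega
      · have := (mem_freeRows.1 hi).1
        omega
    · exact h1 i (j + 1) (by omega)
  · rintro i i' (_ | _ | j) hi hii hj hij h
    · rfl
    · exact c2 i i' hii h
    · exact h2 i i' (j + 1) hi hii (by omega) (by omega) h
  · rintro i (_ | _ | j) (_ | _ | j') hi hj hjj hij h
    any_goals rfl
    any_goals omega
    · refine c1 i fun hi' => ?_
      rcases Finset.mem_insert.1 hi' with rfl | hi'
      · omega
      · exact (mem_freeRows.1 hi').2 _ h
    · exact h3 i (j + 1) (j' + 1) hi (by omega) (by omega) (by omega) h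
  · rintro i (_ | _ | j) hi hj hij
    · omega
    · have : i = n + 1 := by omega
      subst this
      exact hn
    · exact h4 i (j + 1) hi (by omega) (by omega)

theorem IsStaircase.tail {n : ℕ} {S : ℕ → ℕ → StairSymb} (hS : IsStaircase (n + 1) S) :
    IsStaircase n (fun i j => if j = 0 then StairSymb.empty else S i (j + 1)) := by
  obtain ⟨h1, h2, h3, h4⟩ := hS
  refine ⟨fun i j h => ?_, fun i i' j hi hii hj hij h => ?_,
    fun i j j' hi hj hjj hij h => ?_, fun i j hi hj hij => ?_⟩
  · dsimp only
    split_ifs with hj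
    · rfl
    · exact h1 _ _ (by omega)
  · have : j ≠ 0 := by omega
    simp only [this, if_false] at h ⊢
    exact h2 i i' (j + 1) hi hii (by omega) (by omega) h
  · have : j ≠ 0 := by omega
    have : j' ≠ 0 := by omega
    simp only [*, if_false] at h ⊢
    exact h3 i (j + 1) (j' + 1) hi (by omega) (by omega) (by omega) h
  · have : j ≠ 0 := by omega
    simp only [this, if_false]
    exact h4 _ _ hi (by omega) (by omega)

theorem IsStaircase.firstCol_mem {n : ℕ} {S : ℕ → ℕ → StairSymb} (hS : IsStaircase (n + 1) S) :
    (fun i => S i 1) ∈ stairCols (insert (n + 1)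
      (freeRows n (fun i j => if j = 0 then StairSymb.empty else S i (j + 1)))) := by
  obtain ⟨h1, h2, h3, h4⟩ := hS
  refine mem_stairCols.2 ⟨fun i hi => ?_, fun i i' hii h => ?_⟩
  · by_contra hne
    have hi1 : 1 ≤ i ∧ 1 ≤ 1 ∧ i + 1 ≤ n + 1 + 1 := by
      by_contra hc
      exact hne (h1 i 1 hc)
    simp only [Finset.mem_insert, mem_freeRows, not_or, not_and, not_forall] at hi
    obtain ⟨j, hj⟩ := hi.2 (by omega)
    by_cases hj0 : j = 0
    · simp [hj0] at hj
    · simp only [hj0, if_false, ne_eq, not_not] at hj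
      refine hne (h3 i 1 (j + 1) hi1.1 le_rfl (by omega) ?_ hj)
      by_contra hc
      rw [h1 i (j + 1) (by omega)] at hj
      cases hj
  · by_cases hi : 1 ≤ i
    · refine h2 i i' 1 hi hii le_rfl ?_ h
      by_contra hc
      rw [h1 i' 1 (by omega)] at h
      cases h
    · exact h1 i 1 (by omega)

theorem consCol_tail {n : ℕ} {S : ℕ → ℕ → StairSymb} (hS : IsStaircase n S) :
    consCol (fun i j => if j = 0 then StairSymb.empty else S i (j + 1)) (fun i => S i 1) = S := by
  funext i j
  match j with
  | 0 => exact (hS.col_zero i).symm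
  | 1 => rfl
  | j + 2 => rfl

open Classical in
/-- The finite set of tableaux of size `n`, built up one column at a time. -/
noncomputable def stairTabs : ℕ → Finset (ℕ → ℕ → StairSymb)
  | 0 => {fun _ _ => StairSymb.empty}
  | n + 1 => ((stairTabs n).sigma fun S => (stairCols (insert (n + 1) (freeRows n S))).filter
      (fun c => c (n + 1) ≠ StairSymb.empty)).image fun x => consCol x.1 x.2

theorem mem_stairTabs {n : ℕ} {S : ℕ → ℕ → StairSymb} : S ∈ stairTabs n ↔ IsStaircase n S := by
  classical
  induction n generalizing S with
  | zero =>
    simp only [stairTabs, Finset.mem_singleton]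
    constructor
    · rintro rfl
      exact ⟨fun _ _ _ => rfl, fun _ _ _ _ _ _ _ _ => rfl, fun _ _ _ _ _ _ _ _ => rfl,
        fun _ _ _ _ _ => by omega⟩
    · intro h
      funext i j
      exact h.1 i j (by omega)
  | succ n ih =>
    simp only [stairTabs, Finset.mem_image, Finset.mem_sigma, Finset.mem_filter, Sigma.exists]
    constructor
    · rintro ⟨S, c, ⟨hS, hc, hn⟩, rfl⟩
      exact isStaircase_consCol (ih.1 hS) hc hn
    · intro h
      exact ⟨_, _, ⟨ih.2 h.tail, h.firstCol_mem, h.2.2.2 (n + 1) 1 (by omega) le_rfl (by omega)⟩,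
        consCol_tail h⟩

theorem sum_stairTabs_succ (n : ℕ) (f : (ℕ → ℕ → StairSymb) → ℝ) :
    ∑ S ∈ stairTabs (n + 1), f S = ∑ S ∈ stairTabs n,
      ∑ c ∈ stairCols (insert (n + 1) (freeRows n S)),
        open Classical in if c (n + 1) ≠ StairSymb.empty then f (consCol S c) else 0 := by
  classical
  have h : stairTabs (n + 1) = ((stairTabs n).sigma fun S =>
    (stairCols (insert (n + 1) (freeRows n S))).filter
      (fun c => c (n + 1) ≠ StairSymb.empty)).image fun x => consCol x.1 x.2 := by
    ext S
    simp [stairTabs]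
  rw [h, Finset.sum_image, Finset.sum_sigma]
  · refine Finset.sum_congr rfl fun S _ => ?_
    rw [Finset.sum_filter]
  · rintro ⟨S, c⟩ hx ⟨S', c'⟩ hx' he
    simp only [Finset.coe_sigma, Set.mem_sigma_iff, Finset.mem_coe] at hx hx'
    have hS := mem_stairTabs.1 hx.1
    have hS' := mem_stairTabs.1 hx'.1
    have h1 : S = S' := by
      funext i j
      match j with
      | 0 => rw [hS.col_zero, hS'.col_zero]
      | j + 1 => exact congrFun (congrFun he i) (j + 2)
    have h2 : c = c' := by
      funext i
      exact congrFun (congrFun he i) 1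
    subst h1 h2
    rfl

theorem IsStaircase.finite_setOf {n : ℕ} {S : ℕ → ℕ → StairSymb} (hS : IsStaircase n S)
    {s : StairSymb} (hs : s ≠ StairSymb.empty) : {p : ℕ × ℕ | S p.1 p.2 = s}.Finite := by
  refine ((Finset.Icc 1 n) ×ˢ (Finset.Icc 1 n)).finite_toSet.subset fun p hp => ?_
  have : 1 ≤ p.1 ∧ 1 ≤ p.2 ∧ p.1 + p.2 ≤ n + 1 := by
    by_contra h
    exact hs (by rw [← hS.1 _ _ h]; exact hp.symm)
  simp only [Finset.coe_product, Finset.coe_Icc, Set.mem_prod, Set.mem_Icc]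
  omega

theorem ncard_consCol {n : ℕ} {S : ℕ → ℕ → StairSymb} (hS : IsStaircase n S) {F : Finset ℕ}
    {c : ℕ → StairSymb} (hc : c ∈ stairCols F) {s : StairSymb} (hs : s ≠ StairSymb.empty) :
    {p : ℕ × ℕ | consCol S c p.1 p.2 = s}.ncard =
      {p : ℕ × ℕ | S p.1 p.2 = s}.ncard + {i ∈ F | c i = s}.card := by
  have key : {p : ℕ × ℕ | consCol S c p.1 p.2 = s} =
      (fun p : ℕ × ℕ => (p.1, p.2 + 1)) '' {p : ℕ × ℕ | S p.1 p.2 = s} ∪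
        (fun i : ℕ => (i, 1)) '' ↑({i ∈ F | c i = s} : Finset ℕ) := by
    ext ⟨i, j⟩
    simp only [Set.mem_ofPred_eq, Set.mem_union, Set.mem_image, Prod.mk.injEq, Prod.exists,
      Finset.coe_filter]
    match j with
    | 0 =>
      simp only [consCol]
      exact ⟨fun h => absurd h.symm hs, by rintro (⟨a, b, -, -, h⟩ | ⟨a, -, -, h⟩) <;> omega⟩
    | 1 =>
      simp only [consCol]
      constructor
      · refine fun h => Or.inr ⟨i, ⟨?_, h⟩, rfl, trivial⟩
        by_contra hi
        exact hs (h ▸ (mem_stairCols.1 hc).1 i hi)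
      · rintro (⟨a, b, h, rfl, h'⟩ | ⟨a, h, rfl, -⟩)
        · have : b = 0 := by omega
          subst this
          exact absurd (h ▸ hS.col_zero a) hs
        · exact h.2
    | j + 2 =>
      simp only [consCol]
      constructor
      · exact fun h => Or.inl ⟨i, j + 1, h, rfl, rfl⟩
      · rintro (⟨a, b, h, rfl, h'⟩ | ⟨a, -, -, h⟩)
        · have : b = j + 1 := by omega
          exact this ▸ h
        · omega
  have hfin := hS.finite_setOf hs
  rw [key, Set.ncard_union_eq _ (hfin.image _) ((Finset.finite_toSet _).image _),
    Set.ncard_image_of_injective, Set.ncard_image_of_injective, Set.ncard_coe_finset]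
  · intro i i' h
    simpa using h
  · rintro ⟨a, b⟩ ⟨a', b'⟩ h
    simpa using h
  · rw [Set.disjoint_left]
    rintro _ ⟨⟨a, b⟩, hp, rfl⟩ ⟨i, -, h⟩
    simp only [Prod.mk.injEq] at h
    have : b = 0 := by omega
    subst this
    exact hs (hp ▸ hS.col_zero a)

theorem stairWt_consCol (α β : ℝ) {n : ℕ} {S : ℕ → ℕ → StairSymb} (hS : IsStaircase n S)
    {F : Finset ℕ} {c : ℕ → StairSymb} (hc : c ∈ stairCols F) :
    stairWt α β (consCol S c) = stairWt α β S * ∏ i ∈ F, symbWt α β (c i) := by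
  have h : ∀ s, symbWt α β s = (if s = StairSymb.alpha then α else 1) *
      (if s = StairSymb.beta then β else 1) := by
    intro s
    cases s <;> simp [symbWt]
  simp only [stairWt, ncard_consCol hS hc (s := StairSymb.alpha) (by simp),
    ncard_consCol hS hc (s := StairSymb.beta) (by simp), h, Finset.prod_mul_distrib,
    Finset.prod_ite, Finset.prod_const, one_pow, mul_one, pow_add]
  ring

theorem freeRows_consCol (n : ℕ) {S : ℕ → ℕ → StairSymb} (hS : IsStaircase n S)
    (c : ℕ → StairSymb) :
    freeRows (n + 1) (consCol S c) = betaFree (insert (n + 1) (freeRows n S)) c := by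
  ext i
  simp only [mem_freeRows, betaFree, Finset.mem_filter, Finset.mem_insert]
  constructor
  · rintro ⟨hi, h⟩
    refine ⟨?_, h 1⟩
    by_cases hin : i = n + 1
    · exact Or.inl hin
    · refine Or.inr ⟨by omega, fun j => ?_⟩
      match j with
      | 0 => simp [hS.col_zero]
      | j + 1 => exact h (j + 2)
  · rintro ⟨h1, h2⟩
    refine ⟨by omega, fun j => ?_⟩
    match j with
    | 0 => simp [consCol]
    | 1 => exact h2
    | j + 2 =>
      rcases h1 with rfl | h1
      · simp only [consCol]
        rw [hS.1 _ _ (by omega)]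
        simp
      · exact h1.2 _

/-- For every `d ∈ D`, the box of the third main diagonal in the first column of the
subtableau of size `d` is nonempty. -/
def ThirdDiag (D : Finset ℕ) (n : ℕ) (S : ℕ → ℕ → StairSymb) : Prop :=
  ∀ d ∈ D, d ≤ n → S (d - 2) (n + 1 - d) ≠ StairSymb.empty

/-- Weighted sum of `φ (freeRows n S)` over the tableaux `S` of size `n` with `ThirdDiag D n S`. -/
noncomputable def tabSum (α β : ℝ) (D : Finset ℕ) (n : ℕ) (φ : Finset ℕ → ℝ) : ℝ := by
  classical
  exact ∑ S ∈ stairTabs n, if ThirdDiag D n S then stairWt α β S * φ (freeRows n S) else 0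

theorem thirdDiag_consCol {D : Finset ℕ} {n : ℕ} {S : ℕ → ℕ → StairSymb} {c : ℕ → StairSymb} :
    ThirdDiag D (n + 1) (consCol S c) ↔
      ThirdDiag D n S ∧ (n + 1 ∈ D → c (n - 1) ≠ StairSymb.empty) := by
  have hle : ∀ d, d ≤ n → consCol S c (d - 2) (n + 1 + 1 - d) = S (d - 2) (n + 1 - d) := by
    intro d hd
    obtain ⟨k, rfl⟩ := Nat.exists_eq_add_of_le hd
    rw [show d + k + 1 + 1 - d = k + 2 by omega, show d + k + 1 - d = k + 1 by omega]
    rfl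
  have heq : consCol S c (n + 1 - 2) (n + 1 + 1 - (n + 1)) = c (n - 1) := by
    rw [show n + 1 + 1 - (n + 1) = 1 by omega]
    rfl
  constructor
  · intro h
    refine ⟨fun d hd hdn => ?_, fun hn => ?_⟩
    · rw [← hle d hdn]
      exact h d hd (by omega)
    · rw [← heq]
      exact h _ hn le_rfl
  · rintro ⟨h1, h2⟩ d hd hdn
    rcases Nat.lt_or_ge n d with h | h
    · have : d = n + 1 := by omega
      subst this
      rw [heq]
      exact h2 hd
    · rw [hle d h]
      exact h1 d hd h

theorem tabSum_succ (α β : ℝ) (D : Finset ℕ) (n : ℕ) (φ : Finset ℕ → ℝ) :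
    tabSum α β D (n + 1) φ = tabSum α β D n
      (addCol α β n (fun c => n + 1 ∈ D → c (n - 1) ≠ StairSymb.empty) φ) := by
  classical
  unfold tabSum
  rw [sum_stairTabs_succ]
  refine Finset.sum_congr rfl fun S hS => ?_
  replace hS := mem_stairTabs.1 hS
  simp only [addCol, colSum]
  by_cases h : ThirdDiag D n S
  · rw [if_pos h, Finset.mul_sum]
    refine Finset.sum_congr rfl fun c hc => ?_
    simp only [thirdDiag_consCol, h, true_and, stairWt_consCol α β hS hc,
      freeRows_consCol n hS]
    by_cases h1 : c (n + 1) = StairSymb.empty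
    · simp [h1]
    · by_cases h2 : n + 1 ∈ D → c (n - 1) ≠ StairSymb.empty
      · rw [if_pos h1, if_pos h2, if_pos ⟨h1, h2⟩]
        ring
      · rw [if_pos h1, if_neg h2, if_neg fun h => h2 h.2, mul_zero]
  · rw [if_neg h]
    refine Finset.sum_eq_zero fun c _ => ?_
    simp [thirdDiag_consCol, h]

theorem tabSum_congr (α β : ℝ) (D : Finset ℕ) (n : ℕ) {φ ψ : Finset ℕ → ℝ}
    (h : ∀ F ⊆ Finset.Icc 1 n, φ F = ψ F) : tabSum α β D n φ = tabSum α β D n ψ := by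
  classical
  refine Finset.sum_congr rfl fun S _ => ?_
  rw [h _ (freeRows_subset n S)]

theorem tabSum_const_mul (α β x : ℝ) (D : Finset ℕ) (n : ℕ) (φ : Finset ℕ → ℝ) :
    tabSum α β D n (fun F => x * φ F) = x * tabSum α β D n φ := by
  classical
  unfold tabSum
  rw [Finset.mul_sum]
  refine Finset.sum_congr rfl fun S _ => ?_
  rw [mul_ite, mul_zero]
  congr 1
  ring

theorem tabSum_add (α β : ℝ) (D : Finset ℕ) (n : ℕ) (φ ψ : Finset ℕ → ℝ) :
    tabSum α β D n (fun F => φ F + ψ F) = tabSum α β D n φ + tabSum α β D n ψ := by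
  classical
  unfold tabSum
  rw [← Finset.sum_add_distrib]
  refine Finset.sum_congr rfl fun S _ => ?_
  split_ifs <;> ring

/-- The generating function of the number of `β`-free rows. -/
noncomputable def tabGen (α β : ℝ) (D : Finset ℕ) (n : ℕ) (z : ℝ) : ℝ :=
  tabSum α β D n fun F => z ^ F.card

theorem tabSum_succ_of_notMem (α β : ℝ) {D : Finset ℕ} {n : ℕ} (hn : n + 1 ∉ D)
    (φ : Finset ℕ → ℝ) :
    tabSum α β D (n + 1) φ = tabSum α β D n (addCol α β n (fun _ => True) φ) := by
  rw [tabSum_succ]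
  simp [hn]

theorem tabGen_zero (α β z : ℝ) {D : Finset ℕ} (hD : 0 ∉ D) : tabGen α β D 0 z = 1 := by
  have h : ThirdDiag D 0 (fun _ _ => StairSymb.empty) := fun d hd h =>
    absurd (by rwa [Nat.le_zero.1 h] at hd) hD
  have h' : stairTabs 0 = {fun _ _ => StairSymb.empty} := rfl
  simp [tabGen, tabSum, h', h, stairWt, freeRows]

theorem tabGen_succ (α β z : ℝ) {D : Finset ℕ} {n : ℕ} (hn : n + 1 ∉ D) :
    tabGen α β D (n + 1) z = (α * z + β) * tabGen α β D n (z + β) := by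
  rw [tabGen, tabSum_succ_of_notMem α β hn,
    tabSum_congr α β D n fun F hF => addCol_pow_card α β z hF, tabSum_const_mul, tabGen]

theorem tabGen_add_three (α β z : ℝ) {D : Finset ℕ} {n : ℕ} (h3 : n + 3 ∈ D)
    (h2 : n + 2 ∉ D) (h1 : n + 1 ∉ D) :
    tabGen α β D (n + 3) z = α * β * (α * z + β) * (α * β * tabGen α β D n (z + β)
      + (α * (z + β) + β) * tabGen α β D n (z + β + β)) := by
  have e1 : tabGen α β D (n + 3) z = β * (α * z + β) * tabSum α β D (n + 2)
      (fun G => if n + 1 ∈ G then (z + β) ^ (G.erase (n + 1)).card else 0) := by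
    rw [tabGen, tabSum_succ, ← tabSum_const_mul]
    refine tabSum_congr α β D _ fun F hF => ?_
    have := addCol_pow_card_of_nonempty α β z hF
    simp only [h3, forall_const]
    refine this.trans ?_
    rw [mul_ite, mul_zero]
  have e2 : tabSum α β D (n + 2)
      (fun G => if n + 1 ∈ G then (z + β) ^ (G.erase (n + 1)).card else 0) =
      tabSum α β D (n + 1) (fun G => if n + 1 ∈ G then
        (fun k => α * β * (z + β) ^ k + (α * (z + β) + β) * (z + β + β) ^ k)
          (G.erase (n + 1)).card else 0) := by
    rw [tabSum_succ_of_notMem α β h2]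
    exact tabSum_congr α β D _ fun F hF => addCol_indicator_mul_pow α β (z + β) hF
  rw [e1, e2, tabSum_succ_of_notMem α β h1,
    tabSum_congr α β D n fun F hF => addCol_indicator_last α β
      (fun k => α * β * (z + β) ^ k + (α * (z + β) + β) * (z + β + β) ^ k) hF, tabSum_const_mul,
    tabSum_add, tabSum_const_mul, tabSum_const_mul]
  simp only [tabGen]
  ring

theorem finsum_isStaircase (α β : ℝ) {D : Finset ℕ} {n : ℕ}
    {E : (ℕ → ℕ → StairSymb) → Prop} (hE : ∀ S, E S ↔ ThirdDiag D n S) :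
    ∑ᶠ S ∈ {S : ℕ → ℕ → StairSymb | IsStaircase n S ∧ E S}, stairWt α β S =
      tabGen α β D n 1 := by
  classical
  rw [finsum_mem_eq_finite_toFinset_sum _
    ((stairTabs n).finite_toSet.subset fun S hS => mem_stairTabs.2 hS.1), tabGen, tabSum,
    ← Finset.sum_filter]
  refine Finset.sum_congr ?_ fun S _ => by simp
  ext S
  simp [hE, mem_stairTabs]

/-- Closed recursive form of `tabGen` when `r` boxes are required to be nonempty and the size
is `m + 3 * r`. -/
noncomputable def thirdGen (α β : ℝ) : ℕ → ℕ → ℝ → ℝ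
  | 0, m, z => ∏ i ∈ Finset.range m, (α * (z + i * β) + β)
  | r + 1, m, z => α * β * thirdGen α β r (m + 2) z + (α * β) ^ 2 * thirdGen α β r (m + 1) z

theorem thirdGen_succ_right (α β : ℝ) (r m : ℕ) (z : ℝ) :
    thirdGen α β r (m + 1) z = (α * z + β) * thirdGen α β r m (z + β) := by
  induction r generalizing m with
  | zero =>
    simp only [thirdGen]
    rw [Finset.prod_range_succ', mul_comm]
    congr 1
    · simp
    · refine Finset.prod_congr rfl fun i _ => ?_
      push_cast
      ring
  | succ r ih =>
    simp only [thirdGen]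
    rw [ih (m + 2), ih (m + 1)]
    ring

theorem tabGen_eq_thirdGen (α β : ℝ) {D : Finset ℕ} (h3 : ∀ d ∈ D, 3 ≤ d)
    (hgap : ∀ d ∈ D, ∀ d' ∈ D, d < d' → d + 3 ≤ d') (n : ℕ) :
    ∃ m, n = m + 3 * (D.filter (· ≤ n)).card ∧
      ∀ z, tabGen α β D n z = thirdGen α β (D.filter (· ≤ n)).card m z := by
  induction n using Nat.strong_induction_on with
  | _ n ih =>
  have hstep : ∀ k, k + 1 ∉ D → D.filter (· ≤ k + 1) = D.filter (· ≤ k) := by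
    intro k hk
    refine Finset.filter_congr fun d hd => ⟨fun h => ?_, fun h => by omega⟩
    have : d ≠ k + 1 := by
      rintro rfl
      exact hk hd
    omega
  have hstep' : ∀ k, k + 1 ∈ D →
      (D.filter (· ≤ k + 1)).card = (D.filter (· ≤ k)).card + 1 := by
    intro k hk
    have : D.filter (· ≤ k + 1) = insert (k + 1) (D.filter (· ≤ k)) := by
      ext d
      simp only [Finset.mem_filter, Finset.mem_insert]
      constructor
      · rintro ⟨hd, h⟩
        by_cases d = k + 1
        · tauto
        · exact Or.inr ⟨hd, by omega⟩
      · rintro (rfl | ⟨hd, h⟩)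
        · exact ⟨hk, le_rfl⟩
        · exact ⟨hd, by omega⟩
    rw [this, Finset.card_insert_of_notMem (by simp)]
  rcases n with _ | n
  · have : D.filter (· ≤ 0) = ∅ := Finset.filter_false_of_mem fun d hd => by
      have := h3 d hd
      omega
    refine ⟨0, by rw [this]; rfl, fun z => ?_⟩
    rw [this, tabGen_zero α β z fun h => absurd (h3 0 h) (by omega)]
    simp [thirdGen]
  · by_cases hn : n + 1 ∈ D
    · obtain ⟨k, rfl⟩ : ∃ k, n = k + 2 := ⟨n - 2, by have := h3 _ hn; omega⟩
      have hk2 : k + 2 ∉ D := fun h => by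
        have := hgap _ h _ hn (by omega)
        omega
      have hk1 : k + 1 ∉ D := fun h => by
        have := hgap _ h _ hn (by omega)
        omega
      obtain ⟨m, hm, hz⟩ := ih k (by omega)
      have hcard : (D.filter (· ≤ k + 2 + 1)).card = (D.filter (· ≤ k)).card + 1 := by
        rw [hstep' _ hn, hstep (k + 1) hk2, hstep k hk1]
      refine ⟨m, by omega, fun z => ?_⟩
      rw [hcard, tabGen_add_three α β z hn hk2 hk1, hz, hz, thirdGen,
        thirdGen_succ_right α β _ (m + 1), thirdGen_succ_right α β _ m,
        thirdGen_succ_right α β _ m]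
      ring
    · obtain ⟨m, hm, hz⟩ := ih n (by omega)
      refine ⟨m + 1, by rw [hstep n hn]; omega, fun z => ?_⟩
      rw [hstep n hn, tabGen_succ α β z hn, hz, thirdGen_succ_right]

/-- The ratio of `thirdGen` at `z = 1` to the partition function, as a function of
`A = 1/α + 1/β`. -/
noncomputable def thirdRatio (A : ℝ) : ℕ → ℕ → ℝ
  | 0, _ => 1
  | r + 1, m => 1 / ((m : ℝ) + 3 * r + A + 2) * thirdRatio A r (m + 2) +
      1 / ((m : ℝ) + 3 * r + A + 2) * (1 / ((m : ℝ) + 3 * r + A + 1)) * thirdRatio A r (m + 1)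

theorem thirdGen_zero_succ {α β : ℝ} (hα : 0 < α) (hβ : 0 < β) (m : ℕ) :
    thirdGen α β 0 (m + 1) 1 = α * β * (m + (1 / α + 1 / β)) * thirdGen α β 0 m 1 := by
  simp only [thirdGen, Finset.prod_range_succ]
  generalize ∏ i ∈ Finset.range m, (α * (1 + i * β) + β) = p
  field_simp
  ring

theorem thirdGen_zero_pos {α β : ℝ} (hα : 0 < α) (hβ : 0 < β) (m : ℕ) :
    0 < thirdGen α β 0 m 1 := by
  simp only [thirdGen]
  exact Finset.prod_pos fun i _ => by positivity

theorem thirdGen_eq_thirdRatio_mul {α β : ℝ} (hα : 0 < α) (hβ : 0 < β) (r m : ℕ) :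
    thirdGen α β r m 1 = thirdRatio (1 / α + 1 / β) r m * thirdGen α β 0 (m + 3 * r) 1 := by
  induction r generalizing m with
  | zero => simp [thirdRatio]
  | succ r ih =>
    have hrec : thirdGen α β (r + 1) m 1 =
      α * β * thirdGen α β r (m + 2) 1 + (α * β) ^ 2 * thirdGen α β r (m + 1) 1 := rfl
    rw [hrec, ih, ih, show m + 3 * (r + 1) = m + 3 * r + 1 + 1 + 1 by ring,
      show m + 2 + 3 * r = m + 3 * r + 1 + 1 by ring, show m + 1 + 3 * r = m + 3 * r + 1 by ring,
      thirdGen_zero_succ hα hβ (m + 3 * r + 1 + 1), thirdGen_zero_succ hα hβ (m + 3 * r + 1),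
      thirdRatio]
    have hA : 0 < 1 / α + 1 / β := by positivity
    generalize 1 / α + 1 / β = A at *
    have h1 : (m : ℝ) + 3 * r + A + 1 ≠ 0 := by positivity
    have h2 : (m : ℝ) + 3 * r + A + 2 ≠ 0 := by positivity
    push_cast
    field_simp
    ring

theorem thirdRatio_bounds (r : ℕ) : ∃ B C : ℝ, 0 < B ∧ 0 < C ∧ ∀ (A : ℝ) (m : ℕ), 0 < A →
    0 ≤ thirdRatio A r m ∧ thirdRatio A r m ≤ B * (1 / ((m : ℝ) + 3 * r + A)) ^ r ∧
    |thirdRatio A r m - ∏ l : Fin r, 1 / ((m : ℝ) + 3 * r + A - ((l : ℕ) + 1 : ℝ))| ≤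
      C * (1 / ((m : ℝ) + 3 * r + A)) ^ (r + 1) := by
  induction r with
  | zero =>
    refine ⟨1, 1, one_pos, one_pos, fun A m hA => ?_⟩
    simp only [thirdRatio, Finset.univ_eq_empty, Finset.prod_empty, sub_self, abs_zero]
    refine ⟨by norm_num, by norm_num, by positivity⟩
  | succ r ih =>
    obtain ⟨B, C, hB, hC, ih⟩ := ih
    refine ⟨2 * B * 3 ^ (r + 1), (C + B) * 3 ^ (r + 2), by positivity, by positivity,
      fun A m hA => ?_⟩
    obtain ⟨x0, x1, x2⟩ := ih A (m + 2) hA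
    obtain ⟨y0, y1, -⟩ := ih A (m + 1) hA
    rw [Fin.prod_univ_succ, thirdRatio]
    have hprod : ∏ l : Fin r, 1 / ((m : ℝ) + 3 * ((r + 1 : ℕ) : ℝ) + A
        - (((l.succ : Fin (r + 1)) : ℕ) + 1 : ℝ)) =
        ∏ l : Fin r, 1 / (((m + 2 : ℕ) : ℝ) + 3 * r + A - ((l : ℕ) + 1 : ℝ)) := by
      refine Finset.prod_congr rfl fun l _ => ?_
      congr 1
      push_cast [Fin.val_succ]
      ring
    rw [hprod]
    set p := ∏ l : Fin r, 1 / (((m + 2 : ℕ) : ℝ) + 3 * r + A - ((l : ℕ) + 1 : ℝ))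
    have e2 : ((m + 2 : ℕ) : ℝ) + 3 * r + A = (m : ℝ) + 3 * r + A + 2 := by push_cast; ring
    have e1 : ((m + 1 : ℕ) : ℝ) + 3 * r + A = (m : ℝ) + 3 * r + A + 1 := by push_cast; ring
    have e3 : (m : ℝ) + 3 * ((r + 1 : ℕ) : ℝ) + A = (m : ℝ) + 3 * r + A + 3 := by
      push_cast; ring
    have e4 : (m : ℝ) + 3 * r + A + 3 - (((0 : Fin (r + 1)) : ℕ) + 1 : ℝ)
        = (m : ℝ) + 3 * r + A + 2 := by
      simp
      ring
    rw [e2] at x1 x2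
    rw [e1] at y1
    rw [e3, e4]
    have hK : 0 < (m : ℝ) + 3 * r + A := by positivity
    generalize (m : ℝ) + 3 * r + A = K at *
    generalize thirdRatio A r (m + 2) = x at *
    generalize thirdRatio A r (m + 1) = y at *
    set v := 3 * (1 / (K + 3)) with hv
    have hv0 : 0 < v := by positivity
    have hv1 : v ≤ 1 := by
      rw [hv, mul_one_div, div_le_one (by positivity)]
      linarith
    have s0 : 0 < 1 / (K + 2) := by positivity
    have t0 : 0 < 1 / (K + 1) := by positivity
    have s1 : 1 / (K + 2) ≤ v := by
      rw [hv, mul_one_div, div_le_div_iff₀ (by positivity) (by positivity)]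
      linarith
    have t1 : 1 / (K + 1) ≤ v := by
      rw [hv, mul_one_div, div_le_div_iff₀ (by positivity) (by positivity)]
      linarith
    generalize 1 / (K + 2) = s at *
    generalize 1 / (K + 1) = t at *
    have x1' : x ≤ B * v ^ r := x1.trans (by gcongr)
    have y1' : y ≤ B * v ^ r := y1.trans (by gcongr)
    have x2' : |x - p| ≤ C * v ^ (r + 1) := x2.trans (by gcongr)
    have hsty : s * t * y ≤ v * v * (B * v ^ r) := by gcongr
    refine ⟨by positivity, ?_, ?_⟩
    · have h1 : s * x ≤ v * (B * v ^ r) := by gcongr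
      have h2 : v * v * (B * v ^ r) ≤ 1 * v * (B * v ^ r) := by gcongr
      calc s * x + s * t * y ≤ 2 * B * v ^ (r + 1) := by
            rw [pow_succ]
            linarith
        _ = _ := by rw [hv, mul_pow]; ring
    · have h1 : s * |x - p| ≤ v * (C * v ^ (r + 1)) := by gcongr
      calc |s * x + s * t * y - s * p| = |s * (x - p) + s * t * y| := by ring_nf
        _ ≤ |s * (x - p)| + |s * t * y| := abs_add_le _ _
        _ = s * |x - p| + s * t * y := by
            rw [abs_mul, abs_of_pos s0, abs_of_nonneg (by positivity : 0 ≤ s * t * y)]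
        _ ≤ v * (C * v ^ (r + 1)) + v * v * (B * v ^ r) := add_le_add h1 hsty
        _ = (C + B) * v ^ (r + 2) := by ring
        _ = _ := by rw [hv, mul_pow]; ring

/-- Asymptotic joint distribution of nonempty boxes on the third main diagonal: for
columns with consecutive gaps `≥ 3`, the probability differs from
`∏_{l=1}^r 1/(n+a+b−l)` by `O(1/(n+a+b)^{r+1})` uniformly. -/
theorem nonempty_on_third_diagonal_asymptotic (r : ℕ) (hr : 1 ≤ r) :
    ∃ C : ℝ, 0 < C ∧ ∀ n : ℕ, 3 ≤ n → ∀ α β : ℝ, 0 < α → 0 < β →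
      ∀ j : Fin r → ℕ, (∀ l, 1 ≤ j l) → (∀ l, j l ≤ n - 2) → StrictMono j →
      (∀ l : Fin r, ∀ h : (l : ℕ) + 1 < r, j l + 3 ≤ j ⟨(l : ℕ) + 1, h⟩) →
      |stairP n α β (fun S => ∀ l : Fin r, S (n - j l - 1) (j l) ≠ StairSymb.empty)
        - ∏ l : Fin r, 1 / ((n : ℝ) + 1/α + 1/β - ((l : ℕ) + 1 : ℝ))|
        ≤ C / ((n : ℝ) + 1/α + 1/β) ^ (r + 1) := by
  obtain ⟨_, C, _, hC, hbound⟩ := thirdRatio_bounds r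
  refine ⟨C, hC, fun n hn α β hα hβ j hj1 hj2 hmono hgap => ?_⟩
  have hgap' : ∀ l l' : Fin r, l < l' → j l + 3 ≤ j l' := by
    intro l l' hll
    have hl : (l : ℕ) + 1 < r := by omega
    exact (hgap l hl).trans (hmono.monotone (Fin.mk_le_of_le_val (by omega)))
  set D : Finset ℕ := Finset.univ.image fun l => n + 1 - j l with hD
  have hDmem : ∀ d, d ∈ D ↔ ∃ l, n + 1 - j l = d := by simp [hD]
  have hD3 : ∀ d ∈ D, 3 ≤ d ∧ d ≤ n := by
    intro d hd
    obtain ⟨l, rfl⟩ := (hDmem d).1 hd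
    have := hj1 l
    have := hj2 l
    omega
  have hDgap : ∀ d ∈ D, ∀ d' ∈ D, d < d' → d + 3 ≤ d' := by
    intro d hd d' hd' hlt
    obtain ⟨l, rfl⟩ := (hDmem d).1 hd
    obtain ⟨l', rfl⟩ := (hDmem d').1 hd'
    have h1 : l' < l := by
      by_contra h
      have := hmono.monotone (not_lt.1 h)
      omega
    have := hgap' l' l h1
    have := hj2 l
    omega
  have hcard : (D.filter (· ≤ n)).card = r := by
    rw [Finset.filter_true_of_mem fun d hd => (hD3 d hd).2, hD, Finset.card_image_of_injective,
      Finset.card_fin]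
    intro l l' h
    refine hmono.injective ?_
    have := hj2 l
    have := hj2 l'
    simp only at h
    omega
  have hE : ∀ S : ℕ → ℕ → StairSymb,
      (∀ l : Fin r, S (n - j l - 1) (j l) ≠ StairSymb.empty) ↔ ThirdDiag D n S := by
    intro S
    have hidx : ∀ l, n + 1 - j l - 2 = n - j l - 1 ∧ n + 1 - (n + 1 - j l) = j l := by
      intro l
      have := hj1 l
      have := hj2 l
      omega
    constructor
    · intro h d hd _
      obtain ⟨l, rfl⟩ := (hDmem d).1 hd
      rw [(hidx l).1, (hidx l).2]
      exact h l
    · intro h l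
      have := h _ ((hDmem _).2 ⟨l, rfl⟩) (hD3 _ ((hDmem _).2 ⟨l, rfl⟩)).2
      rwa [(hidx l).1, (hidx l).2] at this
  obtain ⟨m, hm, hz⟩ := tabGen_eq_thirdGen α β (fun d hd => (hD3 d hd).1) hDgap n
  rw [hcard] at hm hz
  have hZ : stairZ n α β = thirdGen α β 0 n 1 := by
    obtain ⟨k, hk, hk'⟩ := tabGen_eq_thirdGen α β (D := ∅) (by simp) (by simp) n
    simp only [Finset.filter_empty, Finset.card_empty, mul_zero, add_zero] at hk hk'
    rw [hk, ← hk', ← hk, ← finsum_isStaircase α β (E := fun _ => True) (by simp [ThirdDiag])]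
    simp only [and_true]
    rfl
  have hP : stairP n α β (fun S => ∀ l : Fin r, S (n - j l - 1) (j l) ≠ StairSymb.empty) =
      thirdRatio (1 / α + 1 / β) r m := by
    rw [stairP, finsum_isStaircase α β hE, hZ, hz, thirdGen_eq_thirdRatio_mul hα hβ, ← hm,
      mul_div_cancel_right₀ _ (thirdGen_zero_pos hα hβ n).ne']
  have hN : (n : ℝ) + 1 / α + 1 / β = (m : ℝ) + 3 * r + (1 / α + 1 / β) := by
    rw [hm]
    push_cast
    ring
  rw [hP, hN]
  refine (hbound _ m (by positivity)).2.2.trans_eq ?_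
  rw [one_div_pow, mul_one_div]
end
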